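/- arXiv:2512.12988 — 2 statements merged into one kernel-verified Lean document; each statement's English description precedes it below -/
import Mathlib

section
/- Let r, σ > 0, let ℓ ≥ 1, and let K = {a_0 < ⋯ < a_{ℓ−1}} be a set of ℓ nonnegative integers. Then |det(U_K)| = e^{−ℓ r²/(4σ²)} √(1/(F_{[ℓ]} F_K)) (r/(√2 σ))^{Σ_K − ℓ(ℓ−1)/2} C_K · Γ_{K,ℓ}. -/
open MeasureTheory

/-- Physicists' Hermite polynomials, via the standard three-term recurrence. -/
noncomputable def hermiteP : ℕ → ℝ → ℝ
  | 0 => fun _ => 1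
  | 1 => fun x => 2 * x
  | n + 2 => fun x => 2 * x * hermiteP (n + 1) x - 2 * (n + 1) * hermiteP n x

/-- Scaled Hermite function `ψ_{j,μ,σ}`. -/
noncomputable def psiH (j : ℕ) (μ σ : ℝ) (x : ℝ) : ℝ :=
  (-1 : ℝ) ^ j * (Real.sqrt (2 ^ j * (Nat.factorial j : ℝ) * σ * Real.sqrt Real.pi))⁻¹ *
    hermiteP j ((x - μ) / σ) * Real.exp (-(x - μ) ^ 2 / (2 * σ ^ 2))

/-- `L²(ℝ)` inner product. -/
noncomputable def ip (f g : ℝ → ℝ) : ℝ := ∫ x, f x * g x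

/-- The `ℓ × ℓ` matrix `U_K` with `(i,j)`-entry `⟨ψ_{j,r,σ}, ψ_{a i,0,σ}⟩`. -/
noncomputable def UKmat (ℓ : ℕ) (σ r : ℝ) (a : Fin ℓ → ℕ) : Matrix (Fin ℓ) (Fin ℓ) ℝ :=
  Matrix.of fun i j => ip (psiH j r σ) (psiH (a i) 0 σ)

/-- `Σ_K = Σ_c a_c`. -/
def SigK {m : ℕ} (a : Fin m → ℕ) : ℕ := ∑ c, a c

/-- `F_K = Π_c a_c!`. -/
def FK {m : ℕ} (a : Fin m → ℕ) : ℕ := ∏ c, Nat.factorial (a c)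

/-- `F_{[ℓ]} = Π_{c<ℓ} c!`. -/
def Fbra (ℓ : ℕ) : ℕ := ∏ c ∈ Finset.range ℓ, Nat.factorial c

/-- `C_K = Π_{c₂<c₁} (a_{c₁} − a_{c₂})`. -/
def CK {m : ℕ} (a : Fin m → ℕ) : ℝ :=
  ∏ p ∈ Finset.univ.filter (fun p : Fin m × Fin m => p.2 < p.1),
    ((a p.1 : ℝ) - (a p.2 : ℝ))

/-- `Γ_{K,b} = (1/b!) Σ_{d=0}^b (−1)^d C(b,d) Π_c (a_c − d)`, for real entries. -/
noncomputable def GamR (m : ℕ) (a : Fin m → ℝ) (b : ℕ) : ℝ :=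
  (1 / (Nat.factorial b : ℝ)) *
    ∑ d ∈ Finset.range (b + 1),
      (-1 : ℝ) ^ d * (Nat.choose b d : ℝ) * ∏ c, (a c - (d : ℝ))

open Polynomial

noncomputable def HPol : ℕ → ℝ[X]
  | 0 => 1
  | 1 => C 2 * X
  | n + 2 => C 2 * X * HPol (n + 1) - C (2 * ((n : ℝ) + 1)) * HPol n

lemma HPol_eval (n : ℕ) (x : ℝ) : (HPol n).eval x = hermiteP n x := by
  induction n using Nat.twoStepInduction with
  | zero => simp [HPol, hermiteP]
  | one => simp [HPol, hermiteP]
  | more n h1 h2 => simp [HPol, hermiteP, h1, h2]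

lemma HPol_deriv (n : ℕ) : derivative (HPol (n + 1)) = C (2 * ((n : ℝ) + 1)) * HPol n := by
  induction n using Nat.twoStepInduction with
  | zero => simp [HPol]
  | one =>
    simp only [HPol, derivative_sub, derivative_mul, derivative_C, derivative_X, derivative_one]
    simp only [map_mul, map_add, map_one, C_ofNat, map_natCast]
    push_cast
    ring
  | more n h1 h2 =>
    rw [HPol, derivative_sub, derivative_mul, derivative_mul, derivative_C_mul, h2, h1]
    rw [show HPol (n+2) = C 2 * X * HPol (n + 1) - C (2 * ((n : ℝ) + 1)) * HPol n from rfl]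
    simp only [map_mul, map_add, map_one, C_ofNat, map_natCast, derivative_C, derivative_X,
      derivative_ofNat, derivative_add, derivative_natCast, derivative_one]
    push_cast
    ring

lemma gInt (P : ℝ[X]) : Integrable (fun y : ℝ => P.eval y * Real.exp (-y ^ 2)) := by
  induction P using Polynomial.induction_on' with
  | add p q hp hq =>
    simp only [eval_add, add_mul]
    exact hp.add hq
  | monomial n c =>
    have := integrable_rpow_mul_exp_neg_mul_sq (b := 1) one_pos (s := n)
      (lt_of_lt_of_le (by norm_num) (Nat.cast_nonneg n))
    simp only [Real.rpow_natCast, neg_one_mul] at this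
    simpa [mul_assoc] using this.const_mul c

noncomputable def gL (P : ℝ[X]) : ℝ := ∫ y : ℝ, P.eval y * Real.exp (-y ^ 2)

lemma gL_add (P Q : ℝ[X]) : gL (P + Q) = gL P + gL Q := by
  unfold gL
  rw [← integral_add (gInt P) (gInt Q)]
  simp only [eval_add, add_mul]

lemma gL_C (c : ℝ) (P : ℝ[X]) : gL (C c * P) = c * gL P := by
  unfold gL
  rw [← integral_const_mul]
  simp only [eval_mul, eval_C, mul_assoc]

lemma gL_one : gL 1 = √Real.pi := by
  have := integral_gaussian 1
  simpa [gL] using this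

lemma gL_X (P : ℝ[X]) : gL (C 2 * X * P) = gL (derivative P) := by
  have h : gL (derivative P + C (-1) * (C 2 * X * P)) = 0 := by
    unfold gL
    refine integral_eq_zero_of_hasDerivAt_of_integrable
      (f := fun y : ℝ => P.eval y * Real.exp (-y ^ 2)) ?_ (gInt _) (gInt _)
    intro x
    have h1 := P.hasDerivAt x
    have h2 : HasDerivAt (fun y : ℝ => Real.exp (-y ^ 2)) (Real.exp (-x ^ 2) * (-(2 * x))) x := by
      have := ((hasDerivAt_pow 2 x).fun_neg).exp
      simpa using this
    refine (h1.fun_mul h2).congr_deriv ?_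
    simp only [eval_add, eval_mul, eval_C, eval_X]
    ring
  rw [gL_add, gL_C] at h
  linarith

noncomputable def gB (s : ℝ) (j n : ℕ) : ℝ :=
  gL ((HPol j).comp (X - C s) * (HPol n).comp (X + C s))

lemma HPol_succ_comp (n : ℕ) (s : ℝ) : (HPol (n + 1)).comp (X + C s) =
    C 2 * X * (HPol n).comp (X + C s) + C (2 * s) * (HPol n).comp (X + C s)
      + C (-1) * derivative ((HPol n).comp (X + C s)) := by
  cases n with
  | zero => simp [HPol]; ring
  | succ n =>
    rw [derivative_comp, HPol_deriv]
    simp only [HPol, sub_comp, mul_comp, C_comp, X_comp, derivative_add, derivative_X, derivative_C]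
    simp only [map_mul, map_neg, map_one]
    ring

lemma HPol_succ_comp' (n : ℕ) (s : ℝ) : (HPol (n + 1)).comp (X - C s) =
    C 2 * X * (HPol n).comp (X - C s) + C (-(2 * s)) * (HPol n).comp (X - C s)
      + C (-1) * derivative ((HPol n).comp (X - C s)) := by
  have := HPol_succ_comp n (-s)
  simp only [map_neg, ← sub_eq_add_neg, mul_neg] at this ⊢
  exact this

lemma gB_right (s : ℝ) (n : ℕ) : gB s 0 (n + 1) = 2 * s * gB s 0 n := by
  unfold gB
  simp only [HPol, one_comp, one_mul]
  rw [HPol_succ_comp, gL_add, gL_add, gL_X, gL_C, gL_C]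
  ring

lemma gB_left (s : ℝ) (j n : ℕ) : gB s (j + 1) n = -(2 * s) * gB s j n +
    gL ((HPol j).comp (X - C s) * derivative ((HPol n).comp (X + C s))) := by
  unfold gB
  rw [HPol_succ_comp']
  set P := (HPol j).comp (X - C s)
  set Q := (HPol n).comp (X + C s)
  rw [show (C 2 * X * P + C (-(2*s)) * P + C (-1) * derivative P) * Q =
    C 2 * X * (P * Q) + C (-(2*s)) * (P * Q) + C (-1) * (derivative P * Q) by ring,
    gL_add, gL_add, gL_X, gL_C, gL_C, derivative_mul, gL_add]
  ring

noncomputable def qP (s : ℝ) : ℕ → ℝ[X]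
  | 0 => 1
  | j + 1 => X * (qP s j).comp (X - C 1) - C (2 * s ^ 2) * qP s j

lemma qP_monic (s : ℝ) (j : ℕ) : (qP s j).Monic ∧ (qP s j).natDegree = j := by
  induction j with
  | zero => simp [qP]
  | succ j ih =>
    obtain ⟨hm, hd⟩ := ih
    have h1 : ((qP s j).comp (X - C 1)).Monic := hm.comp (monic_X_sub_C 1) (by rw [natDegree_X_sub_C]; exact one_ne_zero)
    have h1d : ((qP s j).comp (X - C 1)).natDegree = j := by
      rw [natDegree_comp, hd, natDegree_X_sub_C, mul_one]
    have h2 : (X * (qP s j).comp (X - C 1)).Monic := monic_X.mul h1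
    have h2d : (X * (qP s j).comp (X - C 1)).natDegree = j + 1 := by
      rw [monic_X.natDegree_mul h1, h1d, natDegree_X, add_comm]
    have h3 : (C (2 * s ^ 2) * qP s j).natDegree ≤ j := (natDegree_C_mul_le _ _).trans hd.le
    have h4 : (C (2 * s ^ 2) * qP s j).natDegree < (X * (qP s j).comp (X - C 1)).natDegree := by
      omega
    refine ⟨?_, ?_⟩
    · exact h2.sub_of_left (degree_lt_degree h4)
    · rw [qP, natDegree_sub_eq_left_of_natDegree_lt h4, h2d]

lemma gB_eq (s : ℝ) (hs : s ≠ 0) (j n : ℕ) :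
    gB s j n = √Real.pi * (2 * s) ^ n * (s⁻¹) ^ j * (qP s j).eval (n : ℝ) := by
  induction j generalizing n with
  | zero =>
    induction n with
    | zero => simp [gB, HPol, qP, gL_one]
    | succ n ih => rw [gB_right, ih]; simp [qP]; ring
  | succ j ih =>
    rw [gB_left, ih]
    cases n with
    | zero =>
      simp [HPol, gL, qP]
      field_simp
      ring
    | succ n =>
      rw [derivative_comp, HPol_deriv]
      have : (HPol j).comp (X - C s) * (derivative (X + C s) * (C (2 * ((n:ℝ) + 1)) * HPol n).comp (X + C s)) = C (2 * ((n:ℝ) + 1)) * ((HPol j).comp (X - C s) * (HPol n).comp (X + C s)) := by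
        simp only [mul_comp, C_comp, derivative_add, derivative_X, derivative_C]
        ring
      rw [this, gL_C]
      change _ + _ * gB s j n = _
      rw [ih]
      simp [qP]
      field_simp
      ring

lemma ip_eq (r σ : ℝ) (hr : 0 < r) (hσ : 0 < σ) (j n : ℕ) :
    ip (psiH j r σ) (psiH n 0 σ) =
      (Real.exp (-(r ^ 2) / (4 * σ ^ 2)) *
        ((-1) ^ n * (r / (√2 * σ)) ^ n * (√(n.factorial : ℝ))⁻¹)) *
      (((-1) ^ j * ((r / (√2 * σ)) ^ j)⁻¹ * (√(j.factorial : ℝ))⁻¹) *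
        (qP (r / (2 * σ)) j).eval (n : ℝ)) := by
  set s := r / (2 * σ) with hs
  have hs0 : 0 < s := by positivity
  have h1 : ∀ x : ℝ, psiH j r σ x * psiH n 0 σ x =
      ((-1 : ℝ) ^ j * (√(2 ^ j * (Nat.factorial j : ℝ) * σ * √Real.pi))⁻¹ *
      ((-1 : ℝ) ^ n * (√(2 ^ n * (Nat.factorial n : ℝ) * σ * √Real.pi))⁻¹) *
      Real.exp (-(r ^ 2) / (4 * σ ^ 2))) *
      (fun y : ℝ => ((HPol j).comp (X - C s) * (HPol n).comp (X + C s)).eval y *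
        Real.exp (-y ^ 2)) (x / σ - s) := by
    intro x
    have e1 : x / σ - s - s = (x - r) / σ := by rw [hs]; field_simp; ring
    have e2 : x / σ - s + s = (x - 0) / σ := by ring
    have e3 : Real.exp (-(x - r) ^ 2 / (2 * σ ^ 2)) * Real.exp (-(x - 0) ^ 2 / (2 * σ ^ 2)) =
        Real.exp (-(r ^ 2) / (4 * σ ^ 2)) * Real.exp (-(x / σ - s) ^ 2) := by
      rw [← Real.exp_add, ← Real.exp_add]
      congr 1
      rw [hs]; field_simp; ring
    simp only [eval_mul, eval_comp, eval_sub, eval_add, eval_X, eval_C, e1, e2, HPol_eval, psiH]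
    linear_combination ((-1 : ℝ) ^ j * (√(2 ^ j * (Nat.factorial j : ℝ) * σ * √Real.pi))⁻¹ *
      ((-1 : ℝ) ^ n * (√(2 ^ n * (Nat.factorial n : ℝ) * σ * √Real.pi))⁻¹) *
      hermiteP j ((x - r) / σ) * hermiteP n ((x - 0) / σ)) * e3
  unfold ip
  simp_rw [h1]
  rw [integral_const_mul]
  have h2 := integral_sub_right_eq_self (μ := volume) (fun y : ℝ =>
    ((HPol j).comp (X - C s) * (HPol n).comp (X + C s)).eval y * Real.exp (-y ^ 2)) s
  have h3 := Measure.integral_comp_div (fun x : ℝ => (fun y : ℝ =>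
    ((HPol j).comp (X - C s) * (HPol n).comp (X + C s)).eval y * Real.exp (-y ^ 2)) (x - s)) σ
  rw [h3, h2]
  change _ * (_ • gB s j n) = _
  rw [gB_eq s hs0.ne', abs_of_pos hσ, smul_eq_mul]
  have hpi := Real.pi_pos
  have hj : (0:ℝ) < j.factorial := by positivity
  have hn : (0:ℝ) < n.factorial := by positivity
  have k : ∀ m : ℕ, √(2 ^ m * (Nat.factorial m : ℝ) * σ * √Real.pi) =
      √2 ^ m * √(m.factorial : ℝ) * √(σ * √Real.pi) := by
    intro m
    rw [mul_assoc, Real.sqrt_mul (by positivity), Real.sqrt_mul (by positivity)]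
    congr 2
    rw [Real.sqrt_eq_iff_mul_self_eq (by positivity) (by positivity), ← mul_pow,
      Real.mul_self_sqrt (by norm_num)]
  rw [k, k]
  have ht : r / (√2 * σ) = √2 * s := by
    rw [hs]; field_simp; norm_num
  rw [ht]
  have hw : √(σ * √Real.pi) * √(σ * √Real.pi) = σ * √Real.pi := Real.mul_self_sqrt (by positivity)
  have hw0 : 0 < √(σ * √Real.pi) := by positivity
  have hp0 : 0 < √Real.pi := by positivity
  set w := √(σ * √Real.pi)
  have h22 : (2:ℝ) ^ n = √2 ^ n * √2 ^ n := by
    rw [← mul_pow, Real.mul_self_sqrt (by norm_num)]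
  rw [mul_pow 2 s n, h22, mul_pow, mul_pow]
  have : (w⁻¹ * w⁻¹) * (σ * √Real.pi) = 1 := by rw [← hw]; field_simp
  have hd : (√2 ^ n)⁻¹ * √2 ^ n = 1 := inv_mul_cancel₀ (by positivity)
  simp only [mul_inv, inv_pow]
  calc _ = ((w⁻¹ * w⁻¹) * (σ * √Real.pi)) * ((√2 ^ n)⁻¹ * √2 ^ n) * ((Real.exp (-(r ^ 2) / (4 * σ ^ 2)) *
        ((-1) ^ n * (√2 ^ n * s ^ n) * (√(n.factorial : ℝ))⁻¹)) *
      (((-1) ^ j * ((√2 ^ j)⁻¹ * (s ^ j)⁻¹) * (√(j.factorial : ℝ))⁻¹) *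
        (qP s j).eval (n : ℝ))) := by ring
    _ = _ := by rw [this, hd]; ring

lemma Gam_one (m : ℕ) (a : Fin m → ℝ) : GamR m a m = 1 := by
  set P : ℝ[X] := ∏ c, (X - C (a c)) with hP
  have hm : P.Monic := monic_prod_of_monic _ _ (fun c _ => monic_X_sub_C _)
  have hd : P.natDegree = m := by
    rw [hP, natDegree_prod_of_monic _ _ (fun c _ => monic_X_sub_C _)]; simp
  have h := congrFun P.fwdDiff_iter_degree_eq_factorial 0
  rw [fwdDiff_iter_eq_sum_shift, hd, hm.leadingCoeff] at h
  unfold GamR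
  have h2 : ∑ d ∈ Finset.range (m + 1),
      (-1 : ℝ) ^ d * (Nat.choose m d : ℝ) * ∏ c, (a c - (d : ℝ)) = m.factorial := by
    rw [show (m.factorial : ℝ) = ((1:ℝ) • (m.factorial : ℝ → ℝ)) 0 by simp, ← h]
    refine Finset.sum_congr rfl fun d hdm => ?_
    have hdm' : d ≤ m := Nat.lt_succ_iff.mp (Finset.mem_range.mp hdm)
    have e : ∏ c, (a c - (d : ℝ)) = (-1) ^ m * P.eval (d : ℝ) := by
      rw [hP, eval_prod]
      simp only [eval_sub, eval_X, eval_C]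
      have : ((-1:ℝ)) ^ m = ∏ c : Fin m, (-1) := by simp
      rw [this, ← Finset.prod_mul_distrib]
      exact Finset.prod_congr rfl fun c _ => by ring
    have e2 : (-1 : ℝ) ^ m = (-1) ^ d * (-1) ^ (m - d) := by
      rw [← pow_add, Nat.add_sub_cancel' hdm']
    have e3 : (-1 : ℝ) ^ d * (-1) ^ d = 1 := by rw [← mul_pow]; simp
    rw [e, e2]
    simp only [zero_add, zsmul_eq_mul, nsmul_eq_mul, mul_one]
    push_cast
    linear_combination ((m.choose d : ℝ) * (-1) ^ (m - d) * eval (d : ℝ) P) * e3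
  rw [h2]
  have : (m.factorial : ℝ) ≠ 0 := by positivity
  field_simp

lemma CK_eq {m : ℕ} (a : Fin m → ℕ) :
    (Matrix.vandermonde (fun i => (a i : ℝ))).det = CK a := by
  rw [Matrix.det_vandermonde, CK, Finset.prod_sigma']
  refine Finset.prod_bij' (fun p _ => (p.2, p.1)) (fun p _ => ⟨p.2, p.1⟩) ?_ ?_ ?_ ?_ ?_ <;> simp

/-- Lemma 34. Exact formula for `|det(U_K)|`. -/
theorem stmt12 (r σ : ℝ) (hr : 0 < r) (hσ : 0 < σ) (ℓ : ℕ) (hℓ : 1 ≤ ℓ)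
    (a : Fin ℓ → ℕ) (ha : StrictMono a) :
    |(UKmat ℓ σ r a).det| =
      Real.exp (-((ℓ : ℝ) * r ^ 2) / (4 * σ ^ 2)) *
        Real.sqrt (1 / ((Fbra ℓ : ℝ) * (FK a : ℝ))) *
        (r / (Real.sqrt 2 * σ)) ^ ((SigK a : ℤ) - ((ℓ * (ℓ - 1) / 2 : ℕ) : ℤ)) *
        CK a * GamR ℓ (fun c => (a c : ℝ)) ℓ := by
  have hU : UKmat ℓ σ r a = Matrix.of fun i j =>
      (fun i : Fin ℓ => Real.exp (-(r ^ 2) / (4 * σ ^ 2)) *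
        ((-1) ^ (a i) * (r / (√2 * σ)) ^ (a i) * (√((a i).factorial : ℝ))⁻¹)) i *
      (Matrix.of fun i j => (fun j : Fin ℓ => ((-1) ^ (j:ℕ) * ((r / (√2 * σ)) ^ (j:ℕ))⁻¹ *
        (√((j:ℕ).factorial : ℝ))⁻¹)) j *
        (Matrix.of fun i j : Fin ℓ => (qP (r / (2 * σ)) j).eval (a i : ℝ)) i j) i j := by
    ext i j
    simp only [UKmat, Matrix.of_apply]
    exact ip_eq r σ hr hσ j (a i)
  have hV := Matrix.det_eval_matrixOfPolynomials_eq_det_vandermonde (fun i => (a i : ℝ))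
    (fun j : Fin ℓ => qP (r / (2 * σ)) j) (fun j => (qP_monic _ _).2) (fun j => (qP_monic _ _).1)
  rw [hU, Matrix.det_mul_column, Matrix.det_mul_row, ← hV, CK_eq, Gam_one, mul_one]
  have hC : 0 ≤ CK a := by
    unfold CK
    refine Finset.prod_nonneg fun p hp => ?_
    have : a p.2 < a p.1 := ha (by simpa using hp)
    have : (a p.2 : ℝ) < a p.1 := by exact_mod_cast this
    linarith
  have ht : 0 < r / (√2 * σ) := by positivity
  set t := r / (√2 * σ)
  rw [← mul_assoc, abs_mul, abs_of_nonneg hC, abs_mul, Finset.abs_prod, Finset.abs_prod]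
  congr 1
  simp only [abs_mul, abs_pow, abs_neg, abs_one, one_pow, one_mul, abs_inv, abs_of_pos ht,
    Real.abs_exp, abs_of_nonneg (Real.sqrt_nonneg _), Finset.prod_mul_distrib,
    Finset.prod_inv_distrib, Finset.prod_const, Finset.card_univ, Fintype.card_fin,
    Finset.prod_pow_eq_pow_sum]
  have hS : ∑ i : Fin ℓ, (i : ℕ) = ℓ * (ℓ - 1) / 2 := by
    rw [Fin.sum_univ_eq_sum_range (fun i => i), Finset.sum_range_id]
  have hF : (Fbra ℓ : ℝ) = ∏ i : Fin ℓ, ((i : ℕ).factorial : ℝ) := by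
    rw [Fbra, ← Fin.prod_univ_eq_prod_range]; push_cast; rfl
  have hK : (FK a : ℝ) = ∏ i : Fin ℓ, ((a i).factorial : ℝ) := by
    rw [FK]; push_cast; rfl
  have hsq : ∀ f : Fin ℓ → ℕ, ∏ i, √((f i).factorial : ℝ) = √(∏ i, ((f i).factorial : ℝ)) := by
    intro f
    rw [Real.sqrt_prod _ (fun i _ => by positivity)]
  rw [hS, hsq a, hsq (fun i => (i : ℕ)), ← hF, ← hK, zpow_sub₀ ht.ne', zpow_natCast, zpow_natCast,
    ← Real.exp_nat_mul, one_div, Real.sqrt_inv, Real.sqrt_mul (by positivity), mul_inv]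
  rw [show (ℓ : ℝ) * (-r ^ 2 / (4 * σ ^ 2)) = -((ℓ : ℝ) * r ^ 2) / (4 * σ ^ 2) by ring]
  unfold SigK
  rw [div_eq_mul_inv]
  ring
end

section
/- Let σ > 0, c_1 < c_2 with r = c_2 − c_1, and let r_1, r_2 > 0, w_1, w_2 ∈ (0,1]. For i = 1,2 let f_i(x) = ∫ g_{u,σ}(x) dV_i(u) with supp(V_i) ⊆ [c_i − r_i, c_i + r_i], λ_{i,j} = w_i⟨f_i, ψ_{j,c_i,σ}⟩, and define 𝓔_t = Σ_{j=ℓ}^∞ λ_{1,j} A^{−1} z_{1,j} + Σ_{j=ℓ}^∞ λ_{2,j} A^{−1} z_{2,j}. If 8 max(r_1, r_2) < r, then for i = 1,2 and every k ∈ [ℓ]: |(𝓔_t)_{i,k}| ≤ [r e^{5r²/(4σ²)} / (√(2σ√π)(r − 2 max(r_1, r_2)))] · (8 max(r_1, r_2)/r)^ℓ; in particular the right-hand side tends to 0 as ℓ → ∞. -/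
open MeasureTheory

noncomputable def gaussD (u σ x : ℝ) : ℝ :=
  (1 / (Real.sqrt (2 * Real.pi) * σ)) * Real.exp (-(x - u) ^ 2 / (2 * σ ^ 2))

/-- The two centers `c₁, c₂` as a function on `Fin 2`. -/
noncomputable def cent (c₁ c₂ : ℝ) : Fin 2 → ℝ := ![c₁, c₂]

/-- The `2ℓ × 2ℓ` Gram matrix `A` of the scaled Hermite functions. -/
noncomputable def matA (ℓ : ℕ) (c₁ c₂ σ : ℝ) :
    Matrix (Fin 2 × Fin ℓ) (Fin 2 × Fin ℓ) ℝ :=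
  Matrix.of fun p q => ip (psiH p.2 (cent c₁ c₂ p.1) σ) (psiH q.2 (cent c₁ c₂ q.1) σ)

/-- The vector `z_{1,j}`: zero in the `(1,k)` entries,
`⟨ψ_{j,c₁,σ}, ψ_{k,c₂,σ}⟩` in the `(2,k)` entries. -/
noncomputable def zvec1 (ℓ : ℕ) (c₁ c₂ σ : ℝ) (j : ℕ) : Fin 2 × Fin ℓ → ℝ :=
  fun p => if p.1 = 0 then 0 else ip (psiH j c₁ σ) (psiH p.2 c₂ σ)

/-- The vector `z_{2,j}`: `⟨ψ_{j,c₂,σ}, ψ_{k,c₁,σ}⟩` in the `(1,k)` entries,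
zero in the `(2,k)` entries. -/
noncomputable def zvec2 (ℓ : ℕ) (c₁ c₂ σ : ℝ) (j : ℕ) : Fin 2 × Fin ℓ → ℝ :=
  fun p => if p.1 = 0 then ip (psiH j c₂ σ) (psiH p.2 c₁ σ) else 0

open MeasureTheory
namespace S17
open Polynomial

lemma sgn_exists (d : ℕ) : ∀ q : ℝ[X], q.natDegree ≤ d →
    ∃ s : ℕ → ℝ, (∀ n, s n = 1 ∨ s n = -1) ∧ (∀ n : ℕ, 0 ≤ s n * q.eval (n : ℝ)) ∧
      ∃ C : Finset ℕ, C.card ≤ d ∧ ∀ n, n ∉ C → s (n + 1) = s n := by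
  have noroot : ∀ q : ℝ[X], (¬ ∃ x, q.eval x = 0) → ∃ s : ℕ → ℝ, (∀ n, s n = 1 ∨ s n = -1) ∧
      (∀ n : ℕ, 0 ≤ s n * q.eval (n : ℝ)) ∧
      ∃ C : Finset ℕ, C.card ≤ 0 ∧ ∀ n, n ∉ C → s (n + 1) = s n := by
    intro q hq
    by_cases h : ∃ x, q.eval x < 0
    · refine ⟨fun _ => -1, fun _ => Or.inr rfl, fun n => ?_, ∅, by simp, fun _ _ => rfl⟩
      by_contra hn
      obtain ⟨x, hx⟩ := h
      exact hq (mem_range_of_exists_le_of_exists_ge q.continuous ⟨x, hx.le⟩ ⟨(n : ℝ), by linarith⟩)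
    · push Not at h
      exact ⟨fun _ => 1, fun _ => Or.inl rfl, fun n => by simpa using h n, ∅, by simp, fun _ _ => rfl⟩
  induction d with
  | zero =>
    intro q hq
    by_cases h : ∃ x, q.eval x = 0
    · obtain ⟨x, hx⟩ := h
      rw [Polynomial.eq_C_of_natDegree_le_zero hq] at hx ⊢
      simp only [eval_C] at hx
      exact ⟨fun _ => 1, fun _ => Or.inl rfl, fun n => by simp [hx], ∅, by simp, fun _ _ => rfl⟩
    · exact noroot q h
  | succ d ih =>
    intro q hq
    by_cases h : ∃ x, q.eval x = 0
    · obtain ⟨x, hx⟩ := h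
      obtain ⟨q1, rfl⟩ := dvd_iff_isRoot.mpr (show q.IsRoot x from hx)
      have hd : q1.natDegree ≤ d := by
        by_cases h0 : q1 = 0
        · simp [h0]
        · rw [natDegree_mul (X_sub_C_ne_zero x) h0, natDegree_X_sub_C] at hq
          omega
      obtain ⟨s, hs, hs', C, hC, hC'⟩ := ih q1 hd
      refine ⟨fun n => s n * (if x ≤ n then 1 else -1), fun n => ?_, fun n => ?_,
        insert (⌈x⌉₊ - 1) C, (Finset.card_insert_le _ _).trans (by omega), fun n hn => ?_⟩
      · by_cases hx : x ≤ n <;> rcases hs n with h | h <;> simp [h, hx]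
      · have := hs' n
        simp only [eval_mul, eval_sub, eval_X, eval_C]
        split_ifs with h
        · nlinarith [mul_nonneg this (sub_nonneg.mpr h)]
        · push Not at h
          nlinarith [mul_nonneg this (sub_nonneg.mpr h.le)]
      · simp only [Finset.mem_insert, not_or] at hn
        simp only
        rw [hC' n hn.2]
        congr 1
        by_cases h1 : x ≤ n
        · rw [if_pos h1, if_pos]; push_cast; linarith
        · rw [if_neg h1, if_neg]
          intro h2
          apply hn.1
          have : ⌈x⌉₊ = n + 1 := by
            rw [Nat.ceil_eq_iff (by omega)]
            push_cast at h2 ⊢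
            constructor
            · simpa using h1
            · exact h2
          omega
    · obtain ⟨s, hs, hs', C, hC, hC'⟩ := noroot q h
      exact ⟨s, hs, hs', C, by omega, hC'⟩

lemma p_exists (l j : ℕ) (hj : l ≤ j) (q : ℝ[X]) (hq : q.natDegree < l) :
    ∃ N : Finset ℕ, N.card < l ∧ (∀ m ∈ N, l ≤ m ∧ m ≠ j) ∧
      ∀ n : ℕ, l ≤ n → 0 ≤ (∏ m ∈ N, ((n : ℝ) - m)) * q.eval (n : ℝ) *
        ((∏ m ∈ N, ((j : ℝ) - m)) * q.eval (j : ℝ)) := by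
  obtain ⟨s, hs, hs', C, hC, hC'⟩ := sgn_exists (l - 1) q (by omega)
  set C' := C.filter (fun c => l ≤ c ∧ s (c + 1) ≠ s c) with hCC
  set g : ℕ → ℕ := fun c => if j ≤ c then c + 1 else c with hg
  have hinj : Function.Injective g := by
    intro a b hab
    simp only [hg] at hab
    split_ifs at hab <;> omega
  refine ⟨C'.image g, ?_, ?_, ?_⟩
  · have := Finset.card_image_le (s := C') (f := g)
    have : C'.card ≤ C.card := Finset.card_filter_le _ _
    omega
  · intro m hm
    obtain ⟨c, hc, rfl⟩ := Finset.mem_image.mp hm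
    have := (Finset.mem_filter.mp hc).2.1
    simp only [hg]
    split_ifs <;> omega
  · intro n hn
    rw [Finset.prod_image (fun a _ b _ h => hinj h), Finset.prod_image (fun a _ b _ h => hinj h)]
    set τ : ℕ → ℕ → ℝ := fun c n => if (j ≤ c ∧ c < n) ∨ (c < j ∧ n ≤ c) then -1 else 1 with hτ
    have step : ∀ n, l ≤ n → (∏ c ∈ C', τ c (n+1)) * s (n+1) = (∏ c ∈ C', τ c n) * s n := by
      intro n hn
      have e1 : ∀ c ∈ C', τ c (n + 1) = τ c n * (if n = c then -1 else 1) := by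
        intro c _
        simp only [hτ]
        rcases lt_trichotomy n c with h | h | h
        · rw [if_neg h.ne, mul_one]
          congr 1
          apply propext
          omega
        · subst h
          rw [if_pos rfl]
          by_cases h2 : j ≤ n
          · rw [if_pos (by omega), if_neg (by omega)]; norm_num
          · rw [if_neg (by omega), if_pos (by omega)]; norm_num
        · rw [if_neg h.ne', mul_one]
          congr 1
          apply propext
          omega
      rw [Finset.prod_congr rfl e1, Finset.prod_mul_distrib, Finset.prod_ite_eq]
      by_cases hm : n ∈ C'
      · have hne := (Finset.mem_filter.mp hm).2.2
        have : s (n + 1) = - s n := by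
          rcases hs n with h | h <;> rcases hs (n + 1) with h' | h' <;> rw [h, h'] at hne ⊢ <;> simp at hne ⊢
        rw [if_pos hm, this]; ring
      · have : s (n + 1) = s n := by
          by_contra hne
          apply hm
          refine Finset.mem_filter.mpr ⟨?_, hn, hne⟩
          by_contra h
          exact hne (hC' n h)
        rw [if_neg hm, this]; ring
    have hjj : (∏ c ∈ C', τ c j) = 1 := by
      apply Finset.prod_eq_one
      intro c _
      simp only [hτ]
      rw [if_neg]; omega
    have key : ∀ n, l ≤ n → (∏ c ∈ C', τ c n) * s n = (∏ c ∈ C', τ c l) * s l := by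
      intro n hn
      induction n, hn using Nat.le_induction with
      | base => rfl
      | succ n hn ih => rw [step n hn, ih]
    have e : (∏ c ∈ C', τ c n) * s n = s j := by
      rw [key n hn, ← key j hj, hjj, one_mul]
    have pos : 0 ≤ ∏ c ∈ C', (τ c n * (((n : ℝ) - g c) * ((j : ℝ) - g c))) := by
      apply Finset.prod_nonneg
      intro c _
      simp only [hτ, hg]
      by_cases h1 : j ≤ c
      · have hj1 : (j : ℝ) ≤ c := by exact_mod_cast h1
        rw [if_pos h1]
        by_cases h2 : c < n
        · have : ((c + 1 : ℕ) : ℝ) ≤ n := by exact_mod_cast h2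
          push_cast at this ⊢
          rw [if_pos (by omega)]
          nlinarith
        · have : (n : ℝ) ≤ c := by exact_mod_cast (by omega)
          push_cast at this ⊢
          rw [if_neg (by omega)]
          nlinarith
      · have hj1 : (c : ℝ) ≤ j := by exact_mod_cast (by omega)
        rw [if_neg h1]
        by_cases h2 : c < n
        · have : (c : ℝ) ≤ n := by exact_mod_cast h2.le
          rw [if_neg (by omega)]
          nlinarith
        · have : (n : ℝ) ≤ c := by exact_mod_cast (by omega)
          rw [if_pos (by omega)]
          nlinarith
    rw [Finset.prod_mul_distrib, Finset.prod_mul_distrib] at pos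
    have h2 : ∀ n, s n * s n = 1 := fun n => by rcases hs n with h | h <;> simp [h]
    have h3 : ∏ c ∈ C', τ c n = s j * s n := by
      rw [← e, mul_assoc, h2, mul_one]
    rw [h3] at pos
    have h4 := mul_nonneg pos (mul_nonneg (hs' n) (hs' j))
    have : s j * s n * ((∏ c ∈ C', ((n:ℝ) - g c)) * ∏ c ∈ C', ((j:ℝ) - g c)) *
      (s n * eval (n:ℝ) q * (s j * eval (j:ℝ) q)) = (s n * s n) * (s j * s j) * ((∏ c ∈ C', ((n:ℝ) - g c)) * eval (n : ℝ) q *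
        ((∏ c ∈ C', ((j:ℝ) - g c)) * eval (j:ℝ) q)) := by ring
    rw [this, h2, h2] at h4
    simpa using h4

lemma prod_antitone (f : ℕ → ℝ) (hf : Antitone f) (h0 : ∀ n, 0 ≤ f n) (N : Finset ℕ) :
    ∏ n ∈ N, f n ≤ ∏ n ∈ Finset.range N.card, f n := by
  induction N using Finset.induction_on_max with
  | empty => simp
  | insert a s ha ih =>
    have hna : a ∉ s := fun h => lt_irrefl _ (ha a h)
    rw [Finset.prod_insert hna, Finset.card_insert_of_notMem hna, Finset.prod_range_succ, mul_comm]
    have : s.card ≤ a := by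
      have : s ⊆ Finset.range a := fun x hx => Finset.mem_range.mpr (ha x hx)
      simpa using Finset.card_le_card this
    exact mul_le_mul ih (hf this) (h0 _) (Finset.prod_nonneg fun _ _ => h0 _)

lemma choose_bd (n k : ℕ) (p : ℝ) (h0 : 0 ≤ p) (h1 : p ≤ 1) :
    (n.choose k : ℝ) * (p ^ k * (1 - p) ^ (n - k)) ≤ 1 := by
  by_cases hk : k ≤ n
  · have := add_pow p (1 - p) n
    simp only [add_sub_cancel, one_pow] at this
    refine le_trans ?_ this.ge
    have := Finset.single_le_sum (f := fun m => p ^ m * (1 - p) ^ (n - m) * (n.choose m : ℝ))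
      (s := Finset.range (n+1)) (fun i _ => by
        have : 0 ≤ 1 - p := by linarith
        positivity) (Finset.mem_range.mpr (Nat.lt_succ_of_le hk))
    simpa [mul_comm] using this
  · rw [Nat.choose_eq_zero_of_lt (by omega)]; simp

lemma up_eq (j b : ℕ) : ∏ s ∈ Finset.range b, (((j + 1 + s : ℕ) : ℝ) / (s + 1)) = ((j + b).choose b : ℝ) := by
  induction b with
  | zero => simp
  | succ b ih =>
    rw [Finset.prod_range_succ, ih]
    have := Nat.add_one_mul_choose_eq (j + b) b
    have h : (((j + b + 1 : ℕ)) : ℝ) * ((j + b).choose b) = ((j+b+1).choose (b+1)) * (b + 1 : ℕ) := by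
      exact_mod_cast this
    rw [← add_assoc, mul_div_assoc', div_eq_iff (by positivity)]
    push_cast at h ⊢
    linarith

lemma lo_eq (j a : ℕ) : ∏ s ∈ Finset.range a, (((j - s : ℕ) : ℝ) / (s + 1)) = (j.choose a : ℝ) := by
  induction a with
  | zero => simp
  | succ b ih =>
    rw [Finset.prod_range_succ, ih, mul_div_assoc', div_eq_iff (by positivity)]
    exact_mod_cast (Nat.choose_succ_right_eq j b).symm

lemma up_bd (j b : ℕ) : ((j + b).choose b : ℝ) ≤ 3 ^ b * (3 / 2) ^ j := by
  have := choose_bd (j + b) b (1/3) (by norm_num) (by norm_num)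
  have e : (1 / 3 : ℝ) ^ b * (1 - 1 / 3) ^ (j + b - b) * (3 ^ b * (3 / 2) ^ j) = 1 := by
    rw [Nat.add_sub_cancel]
    have : (1 / 3 : ℝ) ^ b * (1 - 1 / 3) ^ j * (3 ^ b * (3 / 2) ^ j) = ((1/3) * 3) ^ b * ((1 - 1/3) * (3/2)) ^ j := by
      rw [mul_pow, mul_pow]; ring
    rw [this]; norm_num
  calc ((j + b).choose b : ℝ) = ((j + b).choose b : ℝ) * ((1 / 3 : ℝ) ^ b * (1 - 1 / 3) ^ (j + b - b)) * (3 ^ b * (3 / 2) ^ j) := by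
        rw [mul_assoc, e, mul_one]
    _ ≤ 1 * _ := by gcongr
    _ = _ := one_mul _

lemma lo_bd (j a : ℕ) : (j.choose a : ℝ) ≤ 3 ^ a * (4 / 3) ^ j := by
  by_cases h : a ≤ j
  · obtain ⟨c, rfl⟩ := Nat.exists_eq_add_of_le h
    have := choose_bd (a + c) a (1/4) (by norm_num) (by norm_num)
    have e : (1 / 4 : ℝ) ^ a * (1 - 1 / 4) ^ (a + c - a) * (3 ^ a * (4 / 3) ^ (a + c)) = 1 := by
      rw [Nat.add_sub_cancel_left]
      have : (1 / 4 : ℝ) ^ a * (1 - 1 / 4) ^ c * (3 ^ a * (4 / 3) ^ (a+c)) = ((1/4) * 3 * (4/3)) ^ a * ((1 - 1/4) * (4/3)) ^ c := by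
        simp only [mul_pow, pow_add]; ring
      rw [this]; norm_num
    calc ((a + c).choose a : ℝ) = ((a + c).choose a : ℝ) * ((1 / 4 : ℝ) ^ a * (1 - 1 / 4) ^ (a + c - a)) * (3 ^ a * (4 / 3) ^ (a + c)) := by
          rw [mul_assoc, e, mul_one]
      _ ≤ 1 * _ := by gcongr
      _ = _ := one_mul _
  · rw [Nat.choose_eq_zero_of_lt (by omega)]; simp; positivity

lemma ratio_bd (l j k : ℕ) (hk : k < l) (N : Finset ℕ) (hN : ∀ m ∈ N, l ≤ m ∧ m ≠ j) :
    |∏ m ∈ N, ((k : ℝ) - m)| ≤ 3 ^ N.card * 2 ^ j * |∏ m ∈ N, ((j : ℝ) - m)| := by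
  have h1 : |∏ m ∈ N, ((k : ℝ) - m)| ≤ (∏ m ∈ N, ((m : ℝ) / |(j : ℝ) - m|)) * |∏ m ∈ N, ((j : ℝ) - m)| := by
    rw [Finset.abs_prod, Finset.abs_prod, ← Finset.prod_mul_distrib]
    apply Finset.prod_le_prod (fun _ _ => abs_nonneg _)
    intro m hm
    have hne : (j : ℝ) - m ≠ 0 := sub_ne_zero.mpr (by exact_mod_cast (hN m hm).2.symm)
    rw [div_mul_cancel₀ _ (abs_ne_zero.mpr hne), abs_le]
    have : (k : ℝ) ≤ m := by exact_mod_cast (hk.le.trans (hN m hm).1)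
    have : (0 : ℝ) ≤ k := by positivity
    constructor <;> linarith
  refine h1.trans ?_
  gcongr
  rw [← Finset.prod_filter_mul_prod_filter_not N (fun m => m < j),
    ← Finset.card_filter_add_card_filter_not (s := N) (fun m => m < j)]
  set N1 := N.filter (fun m => m < j)
  set N2 := N.filter (fun m => ¬ m < j)
  have b1 : ∏ m ∈ N1, ((m : ℝ) / |(j : ℝ) - m|) ≤ 3 ^ N1.card * (4 / 3) ^ (j - 1) := by
    have hc : (N1.image (fun m => j - 1 - m)).card = N1.card := by
      apply Finset.card_image_of_injOn
      intro a ha b hb hab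
      have := (Finset.mem_filter.mp ha).2
      have := (Finset.mem_filter.mp hb).2
      simp only at hab
      omega
    have := prod_antitone (fun s => (((j - 1 - s : ℕ) : ℝ) / (s + 1))) (by
      intro a b hab
      have : ((j - 1 - b : ℕ) : ℝ) ≤ ((j - 1 - a : ℕ) : ℝ) := by exact_mod_cast (by omega)
      simp only
      gcongr) (fun n => by positivity) (N1.image (fun m => j - 1 - m))
    rw [hc, lo_eq, Finset.prod_image] at this
    · refine le_trans (le_of_eq ?_) (this.trans (lo_bd _ _))
      apply Finset.prod_congr rfl
      intro m hm
      have hm := (Finset.mem_filter.mp hm).2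
      obtain ⟨d, rfl⟩ := Nat.exists_eq_add_of_lt hm
      have e1 : m + d + 1 - 1 - m = d := by omega
      have e2 : m + d + 1 - 1 - d = m := by omega
      rw [e1, e2, abs_of_nonneg (by push_cast; linarith [(Nat.cast_nonneg d : (0:ℝ) ≤ d)])]
      congr 1; push_cast; ring
    · intro a ha b hb hab
      have := (Finset.mem_filter.mp ha).2
      have := (Finset.mem_filter.mp hb).2
      simp only at hab
      omega
  have b2 : ∏ m ∈ N2, ((m : ℝ) / |(j : ℝ) - m|) ≤ 3 ^ N2.card * (3 / 2) ^ j := by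
    have hlt : ∀ m ∈ N2, j < m := by
      intro m hm
      have h1 := (Finset.mem_filter.mp hm)
      have := (hN m h1.1).2
      omega
    have hinj : Set.InjOn (fun m => m - (j + 1)) (N2 : Set ℕ) := by
      intro a ha b hb hab
      have := hlt a ha
      have := hlt b hb
      simp only at hab
      omega
    have hc : (N2.image (fun m => m - (j + 1))).card = N2.card :=
      Finset.card_image_of_injOn hinj
    have := prod_antitone (fun s => (((j + 1 + s : ℕ) : ℝ) / (s + 1))) (by
      intro a b hab
      have hab' : (a : ℝ) ≤ b := by exact_mod_cast hab
      simp only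
      rw [div_le_div_iff₀ (by positivity) (by positivity)]
      push_cast
      nlinarith [(Nat.cast_nonneg j : (0:ℝ) ≤ j)]) (fun n => by positivity) (N2.image (fun m => m - (j + 1)))
    rw [hc, up_eq, Finset.prod_image hinj] at this
    refine le_trans (le_of_eq ?_) (this.trans (up_bd _ _))
    apply Finset.prod_congr rfl
    intro m hm
    have hm := hlt m hm
    obtain ⟨d, rfl⟩ := Nat.exists_eq_add_of_lt hm
    have e1 : j + d + 1 - (j + 1) = d := by omega
    rw [e1, abs_of_nonpos (by push_cast; linarith [(Nat.cast_nonneg d : (0:ℝ) ≤ d)])]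
    congr 1 <;> push_cast <;> ring
  calc _ ≤ (3 ^ N1.card * (4 / 3) ^ (j - 1)) * (3 ^ N2.card * (3 / 2 : ℝ) ^ j) := by
        apply mul_le_mul b1 b2 (Finset.prod_nonneg fun _ _ => by positivity) (by positivity)
    _ ≤ (3 ^ N1.card * (4 / 3) ^ j) * (3 ^ N2.card * (3 / 2 : ℝ) ^ j) := by
        gcongr
        · norm_num
        · omega
    _ = 3 ^ (N1.card + N2.card) * ((4/3) * (3/2)) ^ j := by rw [mul_pow, pow_add]; ring
    _ = _ := by norm_num
end S17
namespace S17
open Polynomial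

lemma hs_congr {f g : ℕ → ℝ} {a : ℝ} (h : HasSum f a) (e : ∀ n, g n = f n) : HasSum g a := by
  rwa [funext e]

lemma delta_of_rec (G : ℕ → ℕ → ℝ) (h0 : G 0 0 = 1)
    (h1 : ∀ j k : ℕ, √((j : ℝ) + 1) * G (j + 1) k = √(k : ℝ) * G j (k - 1))
    (h2 : ∀ k : ℕ, √((k : ℝ) + 1) * G 0 (k + 1) = 0) (j k : ℕ) :
    G j k = if j = k then 1 else 0 := by
  have hp : ∀ j : ℕ, √((j : ℝ) + 1) ≠ 0 := fun j => (Real.sqrt_pos.mpr (by positivity)).ne'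
  induction j generalizing k with
  | zero =>
    cases k with
    | zero => simpa using h0
    | succ k => simpa [hp k] using h2 k
  | succ j ih =>
    cases k with
    | zero => simpa [hp j] using h1 j 0
    | succ k =>
      have := h1 j (k + 1)
      rw [Nat.add_sub_cancel, ih k] at this
      by_cases h : j = k
      · subst h
        simp only [if_true, mul_one] at this ⊢
        push_cast at this
        exact mul_left_cancel₀ (hp j) (by rw [this, mul_one])
      · simp only [h, if_false, mul_zero] at this
        have h' : ¬ (j + 1 = k + 1) := by omega
        rw [if_neg h']
        exact (mul_eq_zero.mp this).resolve_left (hp j)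

structure Lad (α : ℝ) (D : ℕ → ℕ → ℝ) : Prop where
  h0 : D 0 0 = Real.exp (-α ^ 2 / 2)
  h1 : ∀ n k : ℕ, √((n : ℝ) + 1) * D (n + 1) k = √(k : ℝ) * D n (k - 1) + α * D n k
  h2 : ∀ n k : ℕ, √((k : ℝ) + 1) * D n (k + 1) = √(n : ℝ) * D (n - 1) k - α * D n k

noncomputable def uu (α : ℝ) (n : ℕ) : ℝ := α ^ n / √(n.factorial : ℝ)

lemma uu_sq (α : ℝ) (n : ℕ) : uu α n ^ 2 = (α ^ 2) ^ n / n.factorial := by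
  rw [uu, div_pow, Real.sq_sqrt (by positivity), ← pow_mul, ← pow_mul, mul_comm]

lemma uu_ne (α : ℝ) (hα : α ≠ 0) (n : ℕ) : uu α n ≠ 0 :=
  div_ne_zero (pow_ne_zero _ hα) (Real.sqrt_pos.mpr (by positivity)).ne'

lemma uu_succ (α : ℝ) (n : ℕ) : √((n : ℝ) + 1) * uu α (n + 1) = α * uu α n := by
  rw [uu, uu, Nat.factorial_succ]
  push_cast
  rw [Real.sqrt_mul (by positivity)]
  have : √((n : ℝ) + 1) ≠ 0 := (Real.sqrt_pos.mpr (by positivity)).ne'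
  have : √(n.factorial : ℝ) ≠ 0 := (Real.sqrt_pos.mpr (by positivity)).ne'
  field_simp
  ring

noncomputable def QQ (α : ℝ) : ℕ → ℝ[X]
  | 0 => C (Real.exp (-α ^ 2 / 2))
  | k + 1 => C (1 / √((k : ℝ) + 1)) * (C (1 / α) * (X * (QQ α k).comp (X - C 1)) - C α * QQ α k)

lemma QQ_degree (α : ℝ) (hα : α ≠ 0) (k : ℕ) : (QQ α k).degree = k := by
  induction k with
  | zero => simp [QQ, degree_C, (Real.exp_pos _).ne']
  | succ k ih =>
    have hp : 1 / √((k : ℝ) + 1) ≠ 0 := (one_div_pos.mpr (Real.sqrt_pos.mpr (by positivity))).ne'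
    have hcomp : ((QQ α k).comp (X - C 1)).degree = k := by
      rw [degree_comp (by rw [degree_X_sub_C]; norm_num), ih, degree_X_sub_C, mul_one]
    rw [QQ, degree_C_mul hp, degree_sub_eq_left_of_degree_lt, degree_C_mul (one_div_ne_zero hα),
      degree_mul, hcomp, degree_X]
    · push_cast; exact add_comm _ _
    · rw [degree_C_mul (one_div_ne_zero hα), degree_C_mul hα, degree_mul, hcomp, degree_X, ih]
      exact_mod_cast (by omega)

lemma QQ_span (α : ℝ) (hα : α ≠ 0) (d : ℕ) : ∀ p : ℝ[X], p.degree < d →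
    ∃ β : ℕ → ℝ, p = ∑ m ∈ Finset.range d, C (β m) * QQ α m := by
  induction d with
  | zero =>
    intro p hp
    refine ⟨0, ?_⟩
    have : p = 0 := by
      rw [← degree_eq_bot]
      simpa [Nat.WithBot.lt_zero_iff] using hp
    simp [this]
  | succ d ih =>
    intro p hp
    have hc : (QQ α d).coeff d ≠ 0 := coeff_ne_zero_of_eq_degree (QQ_degree α hα d)
    obtain ⟨β, hβ⟩ := ih (p - C (p.coeff d / (QQ α d).coeff d) * QQ α d) (by
      rw [degree_lt_iff_coeff_zero]
      intro m hm
      rw [coeff_sub, coeff_C_mul]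
      rcases eq_or_lt_of_le hm with rfl | h
      · field_simp; ring
      · rw [coeff_eq_zero_of_degree_lt (p := p) (n := m) (lt_of_lt_of_le hp (by exact_mod_cast h)),
          coeff_eq_zero_of_degree_lt (p := QQ α d) (n := m) (by rw [QQ_degree α hα]; exact_mod_cast h)]
        simp)
    refine ⟨Function.update β d (p.coeff d / (QQ α d).coeff d), ?_⟩
    rw [Finset.sum_range_succ, Function.update_self]
    rw [sub_eq_iff_eq_add] at hβ
    conv_lhs => rw [hβ]
    congr 1
    apply Finset.sum_congr rfl
    intro m hm
    rw [Function.update_of_ne (Finset.mem_range.mp hm).ne]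

lemma D_eq {α : ℝ} (hα : α ≠ 0) {D : ℕ → ℕ → ℝ} (hD : Lad α D) (n k : ℕ) :
    D n k = uu α n * (QQ α k).eval (n : ℝ) := by
  have hp : ∀ j : ℕ, √((j : ℝ) + 1) ≠ 0 := fun j => (Real.sqrt_pos.mpr (by positivity)).ne'
  induction k generalizing n with
  | zero =>
    simp only [QQ, eval_C]
    induction n with
    | zero => simpa [uu] using hD.h0
    | succ n ih =>
      have := hD.h1 n 0
      apply mul_left_cancel₀ (hp n)
      rw [this, ih, ← mul_assoc √((n : ℝ) + 1), uu_succ]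
      simp; ring
  | succ k ih =>
    apply mul_left_cancel₀ (hp k)
    rw [hD.h2, ih, ih, QQ]
    simp only [eval_mul, eval_C, eval_sub, eval_X, eval_comp]
    have := hp k
    cases n with
    | zero => 
      simp
      field_simp
    | succ n =>
      have e : √((n + 1 : ℕ) : ℝ) * uu α n = uu α (n + 1) * ((n + 1 : ℕ) : ℝ) / α := by
        rw [eq_div_iff hα, mul_assoc, mul_comm (uu α n), ← uu_succ, ← mul_assoc]
        push_cast
        rw [Real.mul_self_sqrt (by positivity), mul_comm]
      rw [Nat.add_sub_cancel, ← mul_assoc, e]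
      have e3 : (((n + 1 : ℕ) : ℝ) - 1) = n := by push_cast; ring
      rw [e3]
      field_simp

lemma summ_poly (x : ℝ) (p : ℝ[X]) : Summable (fun n : ℕ => x ^ n / n.factorial * p.eval (n : ℝ)) := by
  induction p using Polynomial.induction_on' with
  | add p q hp hq => simpa [mul_add] using hp.add hq
  | monomial k c =>
    simp only [eval_monomial]
    apply Summable.of_norm_bounded (g := fun n : ℕ => (|c| * k.factorial) * ((Real.exp 1 * |x|) ^ n / n.factorial))
      ((Real.summable_pow_div_factorial _).mul_left _)
    intro n
    have h := Real.pow_div_factorial_le_exp (n : ℝ) (by positivity) k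
    rw [div_le_iff₀ (by positivity)] at h
    rw [norm_mul, norm_mul, norm_div, norm_pow, norm_pow]
    simp only [Real.norm_eq_abs, Nat.abs_cast]
    have e : Real.exp (n : ℝ) = Real.exp 1 ^ n := by rw [← Real.exp_nat_mul]; simp
    rw [e] at h
    calc |x| ^ n / n.factorial * (|c| * (n : ℝ) ^ k) ≤ |x| ^ n / n.factorial * (|c| * (Real.exp 1 ^ n * k.factorial)) := by gcongr
      _ = _ := by rw [mul_pow]; ring

lemma D_summable {α : ℝ} (hα : α ≠ 0) {D : ℕ → ℕ → ℝ} (hD : Lad α D) (k m : ℕ) :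
    Summable (fun n => D n k * D n m) := by
  have := summ_poly (α ^ 2) (QQ α k * QQ α m)
  refine this.congr fun n => ?_
  rw [D_eq hα hD, D_eq hα hD, ← uu_sq, eval_mul]; ring

lemma D_hasSum {α : ℝ} (hα : α ≠ 0) {D : ℕ → ℕ → ℝ} (hD : Lad α D) (k m : ℕ) :
    HasSum (fun n => D n k * D n m) (if k = m then 1 else 0) := by
  set G : ℕ → ℕ → ℝ := fun k m => ∑' n, D n k * D n m with hG
  have hs : ∀ k m, HasSum (fun n => D n k * D n m) (G k m) := fun k m => (D_summable hα hD k m).hasSum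
  have hrec : ∀ k m : ℕ, √((k : ℝ) + 1) * G (k + 1) m = √(m : ℝ) * G k (m - 1) := by
    intro k m
    have a1 : HasSum (fun n : ℕ => D n k * (√((n : ℝ) + 1) * D (n + 1) m)) (√(m : ℝ) * G k (m - 1) + α * G k m) := by
      have := ((hs k (m - 1)).mul_left √(m : ℝ)).add ((hs k m).mul_left α)
      refine hs_congr this (fun n => ?_)
      rw [hD.h1]; ring
    have a2 : HasSum (fun n : ℕ => √(n : ℝ) * D (n - 1) k * D n m) (√(m : ℝ) * G k (m - 1) + α * G k m) := by
      rw [← hasSum_nat_add_iff' 1]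
      simp only [Finset.range_one, Finset.sum_singleton, Nat.cast_zero, Real.sqrt_zero, zero_mul, sub_zero]
      refine hs_congr a1 (fun n => ?_)
      rw [Nat.add_sub_cancel]; push_cast; ring
    have a3 := a2.sub ((hs k m).mul_left α)
    have a4 := (hs (k + 1) m).mul_left √((k : ℝ) + 1)
    have : (fun n : ℕ => √((k : ℝ) + 1) * (D n (k + 1) * D n m)) = fun n : ℕ => √(n : ℝ) * D (n - 1) k * D n m - α * (D n k * D n m) := by
      funext n
      rw [← mul_assoc, hD.h2]; ring
    rw [this] at a4
    rw [a4.unique a3]; ring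
  have h00 : G 0 0 = 1 := by
    refine (hs 0 0).unique ?_
    have := (NormedSpace.expSeries_div_hasSum_exp (𝔸 := ℝ) (α ^ 2)).mul_left (Real.exp (-α ^ 2))
    rw [← Real.exp_eq_exp_ℝ, ← Real.exp_add] at this
    simp only [neg_add_cancel, Real.exp_zero] at this
    refine hs_congr this (fun n => ?_)
    rw [D_eq hα hD, ← uu_sq]
    have : Real.exp (-α ^ 2) = Real.exp (-α ^ 2 / 2) * Real.exp (-α ^ 2 / 2) := by
      rw [← Real.exp_add]; congr 1; ring
    rw [this]
    simp only [QQ, eval_C]; ring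
  have hsymm : ∀ k m, G k m = G m k := fun k m => by
    simp only [hG]; congr 1; funext n; ring
  rw [← delta_of_rec G h00 hrec (fun k => by rw [hsymm, hrec]; simp) k m]
  exact hs k m

end S17
namespace S17
open Polynomial

lemma uu_le (α : ℝ) (n : ℕ) : |uu α n| ≤ Real.exp (α ^ 2 / 2) := by
  apply abs_le_of_sq_le_sq _ (Real.exp_pos _).le
  rw [uu_sq, ← Real.exp_nat_mul]
  refine (Real.pow_div_factorial_le_exp (α ^ 2) (by positivity) n).trans (le_of_eq ?_)
  congr 1; push_cast; ring

lemma abs_le_of_sq (x y : ℝ) (hy : 0 ≤ y) (h : x ^ 2 ≤ y ^ 2) : |x| ≤ y := abs_le_of_sq_le_sq h hy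

/-- key estimate -/
lemma key_bd {α : ℝ} (hα : α ≠ 0) {D : ℕ → ℕ → ℝ} (hD : Lad α D) (l j k : ℕ) (hj : l ≤ j) (hk : k < l)
    (b : Fin l → ℝ)
    (hb : ∀ m : Fin l, b m - ∑ n ∈ Finset.range l, D n m * ∑ m' : Fin l, D n m' * b m' = D k m) :
    |∑ m : Fin l, D j m * b m| * |uu α j| ≤ |uu α k| * (3 ^ (l - 1) * 2 ^ j) := by
  set q : ℝ[X] := ∑ m : Fin l, C (b m) * QQ α m with hq
  have hF : ∀ n : ℕ, ∑ m : Fin l, D n m * b m = uu α n * q.eval (n : ℝ) := by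
    intro n
    rw [hq, eval_finsetSum, Finset.mul_sum]
    refine Finset.sum_congr rfl fun m _ => ?_
    rw [D_eq hα hD, eval_mul, eval_C]; ring
  have s1 : ∀ m : Fin l, HasSum (fun n => D n m * ∑ m' : Fin l, D n m' * b m') (b m) := by
    intro m
    have := hasSum_sum (s := Finset.univ) (f := fun (m' : Fin l) n => D n m * D n m' * b m')
      (a := fun m' : Fin l => (if (m : ℕ) = m' then 1 else 0) * b m')
      (fun m' _ => (D_hasSum hα hD m m').mul_right (b m'))
    have e : ∑ m' : Fin l, (if (m : ℕ) = m' then 1 else 0) * b m' = b m := by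
      simp [Fin.val_inj]
    rw [e] at this
    refine hs_congr this fun n => ?_
    rw [Finset.mul_sum]
    exact Finset.sum_congr rfl fun _ _ => by ring
  have s2 : ∀ m : Fin l, HasSum (fun n => D (n + l) m * (uu α (n + l) * q.eval ((n + l : ℕ) : ℝ))) (D k m) := by
    intro m
    have := (hasSum_nat_add_iff' l).mpr (s1 m)
    rw [hb m] at this
    refine hs_congr this fun n => ?_
    rw [hF]
  have s3 : ∀ p : ℝ[X], p.degree < l → HasSum (fun n => uu α (n + l) * p.eval ((n + l : ℕ) : ℝ) *
      (uu α (n + l) * q.eval ((n + l : ℕ) : ℝ))) (uu α k * p.eval (k : ℝ)) := by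
    intro p hp
    obtain ⟨β, hβ⟩ := QQ_span α hα l p hp
    rw [Finset.sum_range] at hβ
    have e : ∀ n : ℕ, uu α n * p.eval (n : ℝ) = ∑ m : Fin l, D n m * β m := by
      intro n
      rw [hβ, eval_finsetSum, Finset.mul_sum]
      refine Finset.sum_congr rfl fun m _ => ?_
      rw [D_eq hα hD, eval_mul, eval_C]; ring
    have := hasSum_sum (s := Finset.univ) (fun (m : Fin l) _ => (s2 m).mul_right (β m))
    rw [e k]
    refine hs_congr this fun n => ?_
    rw [e, Finset.sum_mul]
    exact Finset.sum_congr rfl fun _ _ => by ring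
  rw [hF]
  by_cases hqj : q.eval (j : ℝ) = 0
  · rw [hqj]; simp; positivity
  have hqd : q.natDegree < l := by
    rw [natDegree_lt_iff_degree_lt (by rintro h; simp [h] at hqj)]
    rw [hq]
    apply lt_of_le_of_lt (degree_sum_le _ _)
    rw [Finset.sup_lt_iff (by exact WithBot.bot_lt_coe l)]
    intro m _
    rw [← smul_eq_C_mul]
    apply lt_of_le_of_lt (degree_smul_le _ _)
    rw [QQ_degree α hα]
    exact_mod_cast m.2
  obtain ⟨N, hN, hN', hpos⟩ := p_exists l j hj q hqd
  set p : ℝ[X] := ∏ m ∈ N, (X - C (m : ℝ)) with hp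
  have hpe : ∀ x : ℝ, p.eval x = ∏ m ∈ N, (x - m) := by
    intro x; rw [hp, eval_prod]; simp
  have hpd : p.degree < l := by
    rw [hp, degree_prod]
    simp only [degree_X_sub_C, Finset.sum_const, nsmul_eq_mul, mul_one]
    exact_mod_cast hN
  have hpj : p.eval (j : ℝ) ≠ 0 := by
    rw [hpe, Finset.prod_ne_zero_iff]
    intro m hm
    exact sub_ne_zero.mpr (by exact_mod_cast (hN' m hm).2.symm)
  have s4 := (s3 p hpd).mul_right (p.eval (j : ℝ) * q.eval (j : ℝ))
  have s5 := le_hasSum s4 (j - l) (fun n _ => by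
    have := hpos (n + l) (by omega)
    rw [← hpe, ← hpe] at this
    have h2 := mul_nonneg (sq_nonneg (uu α (n + l))) this
    refine h2.trans (le_of_eq (by ring)))
  rw [Nat.sub_add_cancel hj] at s5
  have hr := ratio_bd l j k hk N hN'
  rw [← hpe, ← hpe] at hr
  have huj := uu_ne α hα j
  set P := |p.eval (j : ℝ)| with hP
  set Qj := |q.eval (j : ℝ)| with hQ
  have hPp : 0 < P := abs_pos.mpr hpj
  have hQp : 0 < Qj := abs_pos.mpr hqj
  have h6 : |uu α j| ^ 2 * (P * Qj) ^ 2 ≤ |uu α k| * |p.eval (k : ℝ)| * (P * Qj) := by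
    calc |uu α j| ^ 2 * (P * Qj) ^ 2 = uu α j * eval (j:ℝ) p * (uu α j * eval (j:ℝ) q) * (eval (j:ℝ) p * eval (j:ℝ) q) := by
          rw [hP, hQ, mul_pow, sq_abs, sq_abs, sq_abs]; ring
      _ ≤ uu α k * eval (k:ℝ) p * (eval (j:ℝ) p * eval (j:ℝ) q) := s5
      _ ≤ _ := by
        refine (le_abs_self _).trans (le_of_eq ?_)
        rw [abs_mul, abs_mul, abs_mul]
  have h7 : |uu α j| ^ 2 * (P * Qj) ≤ |uu α k| * |p.eval (k : ℝ)| := by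
    have : 0 < P * Qj := by positivity
    refine le_of_mul_le_mul_right ?_ this
    calc _ = |uu α j| ^ 2 * (P * Qj) ^ 2 := by ring
      _ ≤ _ := h6
  have h8 : |uu α j| ^ 2 * (P * Qj) ≤ |uu α k| * (3 ^ N.card * 2 ^ j * P) := h7.trans (by gcongr)
  have h9 : |uu α j| ^ 2 * Qj ≤ |uu α k| * (3 ^ N.card * 2 ^ j) := by
    refine le_of_mul_le_mul_right ?_ hPp
    calc _ = |uu α j| ^ 2 * (P * Qj) := by ring
      _ ≤ _ := h8
      _ = _ := by ring
  rw [abs_mul]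
  calc |uu α j| * Qj * |uu α j| = |uu α j| ^ 2 * Qj := by ring
    _ ≤ _ := h9
    _ ≤ _ := by
      gcongr
      · norm_num
      · omega

theorem core {α : ℝ} (hα : α ≠ 0) {D : ℕ → ℕ → ℝ} (hD : Lad α D) (l j : ℕ) (hj : l ≤ j)
    (hsurj : ∀ t : Fin l → ℝ, ∃ a b : Fin l → ℝ, (∀ k : Fin l, a k + ∑ m : Fin l, D k m * b m = 0) ∧
      ∀ k : Fin l, (∑ m : Fin l, D m k * a m) + b k = t k)
    (a b : Fin l → ℝ) (h1 : ∀ k : Fin l, a k + ∑ m : Fin l, D k m * b m = 0)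
    (h2 : ∀ k : Fin l, (∑ m : Fin l, D m k * a m) + b k = D j k) (k : Fin l) :
    |a k| * |uu α j| ≤ Real.exp (α ^ 2 / 2) * (4 ^ l * 2 ^ j / 2) ∧
    |b k| * |uu α j| ≤ Real.exp (α ^ 2 / 2) * (4 ^ l * 2 ^ j / 2) := by
  have red : ∀ (a b t : Fin l → ℝ), (∀ k : Fin l, a k + ∑ m : Fin l, D k m * b m = 0) →
      (∀ k : Fin l, (∑ m : Fin l, D m k * a m) + b k = t k) → ∀ m : Fin l,
      b m - ∑ n ∈ Finset.range l, D n m * ∑ m' : Fin l, D n m' * b m' = t m := by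
    intro a b t h1 h2 m
    rw [← h2 m, Finset.sum_range, add_comm, sub_eq_add_neg, ← Finset.sum_neg_distrib]
    congr 1
    refine Finset.sum_congr rfl fun n _ => ?_
    rw [eq_neg_of_add_eq_zero_left (h1 n)]; ring
  have hA : ∀ k : Fin l, |a k| * |uu α j| ≤ |uu α k| * (3 ^ (l - 1) * 2 ^ j) := by
    intro k
    obtain ⟨a', b', g1, g2⟩ := hsurj (fun m => D k m)
    have hb' := red a' b' _ g1 g2
    have hkey := key_bd hα hD l j k hj k.2 b' hb'
    have hb := red a b _ h1 h2
    have e : ∑ m : Fin l, D j m * b' m = ∑ m : Fin l, D k m * b m := by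
      have e1 : ∑ m : Fin l, D j m * b' m = ∑ m : Fin l, b m * b' m - ∑ n ∈ Finset.range l, (∑ m : Fin l, D n m * b m) * (∑ m : Fin l, D n m * b' m) := by
        rw [Finset.sum_congr rfl fun m _ => by rw [← hb m]]
        simp only [sub_mul, Finset.sum_sub_distrib, Finset.sum_mul]
        congr 1
        rw [Finset.sum_comm]
        refine Finset.sum_congr rfl fun n _ => ?_
        simp only [Finset.mul_sum, Finset.sum_mul]
        rw [Finset.sum_comm]
        refine Finset.sum_congr rfl fun x _ => Finset.sum_congr rfl fun y _ => by ring
      have e2 : ∑ m : Fin l, D k m * b m = ∑ m : Fin l, b m * b' m - ∑ n ∈ Finset.range l, (∑ m : Fin l, D n m * b m) * (∑ m : Fin l, D n m * b' m) := by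
        rw [Finset.sum_congr rfl fun m _ => by rw [← hb' m]]
        simp only [sub_mul, Finset.sum_sub_distrib, Finset.sum_mul]
        congr 1
        · exact Finset.sum_congr rfl fun m _ => by ring
        rw [Finset.sum_comm]
        refine Finset.sum_congr rfl fun n _ => ?_
        simp only [Finset.mul_sum, Finset.sum_mul]
        refine Finset.sum_congr rfl fun x _ => Finset.sum_congr rfl fun y _ => by ring
      rw [e1, e2]
    rw [eq_neg_of_add_eq_zero_left (h1 k), abs_neg, ← e]
    exact hkey
  have hl : 1 ≤ l := by have := k.2; omega
  have hC : (3 : ℝ) ^ (l - 1) * 2 ^ j + 1 ≤ 4 ^ l * 2 ^ j / 2 := by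
    obtain ⟨l', rfl⟩ := Nat.exists_eq_add_of_le' hl
    rw [Nat.add_sub_cancel, pow_succ]
    have h3 : (3 : ℝ) ^ l' ≤ 4 ^ l' := by gcongr; norm_num
    have h4 : (1 : ℝ) ≤ 4 ^ l' := one_le_pow₀ (by norm_num)
    have h5 : (1 : ℝ) ≤ 2 ^ j := one_le_pow₀ (by norm_num)
    nlinarith [mul_le_mul_of_nonneg_right h3 (by positivity : (0:ℝ) ≤ 2 ^ j)]
  have hcol : ∀ k : ℕ, ∀ s : Finset ℕ, ∑ n ∈ s, D n k ^ 2 ≤ 1 := by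
    intro k s
    have := sum_le_hasSum s (fun n _ => mul_self_nonneg (D n k)) (by simpa using D_hasSum hα hD k k)
    simpa [sq] using this
  have hE : 0 < Real.exp (α ^ 2 / 2) := Real.exp_pos _
  constructor
  · refine (hA k).trans ?_
    apply mul_le_mul (uu_le α k) (by linarith) (by positivity) hE.le
  · have hbk : b k = D j k - ∑ m : Fin l, D m k * a m := by rw [← h2 k]; ring
    have hDj : |D j k| ≤ 1 := by
      have := hcol k {j}
      rw [Finset.sum_singleton] at this
      exact abs_le_of_sq _ _ zero_le_one (by simpa using this)
    have hu : ∑ m : Fin l, uu α m ^ 2 ≤ Real.exp (α ^ 2) := by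
      rw [← Finset.sum_range (fun n => uu α n ^ 2)]
      simp only [uu_sq]
      exact Real.sum_le_exp_of_nonneg (by positivity) l
    have hcs : (∑ m : Fin l, |D m k| * |uu α m|) ≤ Real.exp (α ^ 2 / 2) := by
      refine (le_abs_self _).trans (abs_le_of_sq _ _ hE.le ?_)
      refine (Finset.sum_mul_sq_le_sq_mul_sq _ _ _).trans ?_
      simp only [sq_abs]
      have h3 := hcol k (Finset.range l)
      rw [Finset.sum_range] at h3
      have h4 : Real.exp (α ^ 2 / 2) ^ 2 = Real.exp (α ^ 2) := by
        rw [← Real.exp_nat_mul]; congr 1; push_cast; ring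
      rw [h4]
      calc _ ≤ 1 * Real.exp (α ^ 2) := by
            apply mul_le_mul h3 hu (Finset.sum_nonneg fun _ _ => sq_nonneg _) zero_le_one
        _ = _ := one_mul _
    have hsum : |∑ m : Fin l, D m k * a m| * |uu α j| ≤ Real.exp (α ^ 2 / 2) * (3 ^ (l - 1) * 2 ^ j) := by
      calc |∑ m : Fin l, D m k * a m| * |uu α j| ≤ (∑ m : Fin l, |D m k * a m|) * |uu α j| := by
            gcongr; exact Finset.abs_sum_le_sum_abs _ _
        _ = ∑ m : Fin l, |D m k| * (|a m| * |uu α j|) := by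
            rw [Finset.sum_mul]; refine Finset.sum_congr rfl fun m _ => by rw [abs_mul]; ring
        _ ≤ ∑ m : Fin l, |D m k| * (|uu α m| * (3 ^ (l - 1) * 2 ^ j)) := by
            exact Finset.sum_le_sum fun m _ => mul_le_mul_of_nonneg_left (hA m) (abs_nonneg _)
        _ = (∑ m : Fin l, |D m k| * |uu α m|) * (3 ^ (l - 1) * 2 ^ j) := by
            rw [Finset.sum_mul]; refine Finset.sum_congr rfl fun m _ => by ring
        _ ≤ _ := by gcongr
    calc |b k| * |uu α j| ≤ (|D j k| + |∑ m : Fin l, D m k * a m|) * |uu α j| := by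
          rw [hbk]; gcongr; exact abs_sub _ _
      _ = |D j k| * |uu α j| + |∑ m : Fin l, D m k * a m| * |uu α j| := by ring
      _ ≤ 1 * Real.exp (α ^ 2 / 2) + Real.exp (α ^ 2 / 2) * (3 ^ (l - 1) * 2 ^ j) := by
          gcongr
          exact uu_le α j
      _ = Real.exp (α ^ 2 / 2) * (3 ^ (l - 1) * 2 ^ j + 1) := by ring
      _ ≤ _ := by gcongr
end S17
namespace S17
open Polynomial

theorem hp_poly (n : ℕ) : ∃ p : ℝ[X], ∀ x, hermiteP n x = p.eval x := by
  induction n using Nat.twoStepInduction with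
  | zero => exact ⟨1, fun x => by simp [hermiteP]⟩
  | one => exact ⟨2 * X, fun x => by simp [hermiteP]⟩
  | more n h1 h2 =>
    obtain ⟨p, hp⟩ := h1
    obtain ⟨q, hq⟩ := h2
    refine ⟨2 * X * q - C (2 * ((n:ℝ) + 1)) * p, fun x => ?_⟩
    simp only [hermiteP, hp, hq, eval_sub, eval_mul, eval_C, eval_X, eval_ofNat]

theorem hp_rec (n : ℕ) (x : ℝ) :
    2 * x * hermiteP n x = hermiteP (n+1) x + 2 * n * hermiteP (n-1) x := by
  cases n with
  | zero => simp [hermiteP]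
  | succ n => simp [hermiteP]

theorem hp_deriv (n : ℕ) : ∀ x : ℝ, HasDerivAt (hermiteP n) (2 * n * hermiteP (n-1) x) x := by
  induction n using Nat.twoStepInduction with
  | zero => intro x; simpa [hermiteP] using hasDerivAt_const x (1:ℝ)
  | one => intro x; simpa [hermiteP] using (hasDerivAt_id x).const_mul (2:ℝ)
  | more n h1 h2 =>
    intro x
    have e : hermiteP (n+2) = fun x => 2 * x * hermiteP (n + 1) x - 2 * (n + 1) * hermiteP n x := by
      funext x; simp [hermiteP]
    rw [e]
    have h := (((hasDerivAt_id x).const_mul (2:ℝ)).mul (h2 x)).sub ((h1 x).const_mul (2 * ((n:ℝ)+1)))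
    refine h.congr_deriv ?_
    have := hp_rec n x
    simp only [id, Nat.add_sub_cancel, Nat.add_succ_sub_one] 
    push_cast
    linear_combination (-2 * ((n:ℝ)+1)) * (-this)

theorem int_poly0 (p : ℝ[X]) {b : ℝ} (hb : 0 < b) :
    Integrable (fun x : ℝ => p.eval x * Real.exp (-b * x^2)) := by
  induction p using Polynomial.induction_on' with
  | add p q hp hq =>
    refine (hp.add hq).congr (Filter.Eventually.of_forall fun x => ?_)
    simp [eval_add, add_mul]
  | monomial n a =>
    have := (integrable_rpow_mul_exp_neg_mul_sq hb (s := (n:ℝ)) (by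
      have : (0:ℝ) ≤ n := Nat.cast_nonneg n
      linarith)).const_mul a
    simpa [eval_monomial, Real.rpow_natCast, mul_assoc] using this

theorem int_poly (p : ℝ[X]) {b : ℝ} (hb : 0 < b) (c : ℝ) :
    Integrable (fun x : ℝ => p.eval x * Real.exp (-b * (x-c)^2)) := by
  have := (int_poly0 (p.comp (X + C c)) hb).comp_sub_right c
  simpa using this

/-- product weight -/
noncomputable def wt (μ ν σ x : ℝ) : ℝ :=
  Real.exp (-(x - μ) ^ 2 / (2 * σ ^ 2)) * Real.exp (-(x - ν) ^ 2 / (2 * σ ^ 2))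

theorem wt_eq {σ : ℝ} (hσ : 0 < σ) (μ ν x : ℝ) :
    wt μ ν σ x = Real.exp (-(μ-ν)^2/(4*σ^2)) * Real.exp (-(1/σ^2) * (x - (μ+ν)/2)^2) := by
  unfold wt
  rw [← Real.exp_add, ← Real.exp_add]
  congr 1
  field_simp
  ring

theorem int_wt {σ : ℝ} (hσ : 0 < σ) (μ ν : ℝ) (p : ℝ[X]) :
    Integrable (fun x : ℝ => p.eval x * wt μ ν σ x) := by
  have := (int_poly p (b := 1/σ^2) (by positivity) ((μ+ν)/2)).const_mul
    (Real.exp (-(μ-ν)^2/(4*σ^2)))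
  refine this.congr (Filter.Eventually.of_forall fun x => ?_)
  simp only [wt_eq hσ]
  ring

theorem int_hh {σ : ℝ} (hσ : 0 < σ) (μ ν : ℝ) (j k : ℕ) :
    Integrable (fun x : ℝ => hermiteP j ((x-μ)/σ) * hermiteP k ((x-ν)/σ) * wt μ ν σ x) := by
  obtain ⟨p, hp⟩ := hp_poly j
  obtain ⟨q, hq⟩ := hp_poly k
  have := int_wt hσ μ ν (p.comp (C σ⁻¹ * (X - C μ)) * q.comp (C σ⁻¹ * (X - C ν)))
  refine this.congr (Filter.Eventually.of_forall fun x => ?_)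
  simp [hp, hq, div_eq_inv_mul]

/-- unnormalised -/
noncomputable def II (μ ν σ : ℝ) (j k : ℕ) : ℝ :=
  ∫ x : ℝ, hermiteP j ((x-μ)/σ) * hermiteP k ((x-ν)/σ) * wt μ ν σ x

theorem wt_comm (μ ν σ x : ℝ) : wt μ ν σ x = wt ν μ σ x := by
  unfold wt; ring

theorem II_comm (μ ν σ : ℝ) (j k : ℕ) : II μ ν σ j k = II ν μ σ k j := by
  unfold II
  congr 1; funext x
  rw [wt_comm]; ring

theorem wt_deriv {σ : ℝ} (hσ : 0 < σ) (μ ν x : ℝ) :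
    HasDerivAt (wt μ ν σ) (-(1/σ) * ((x-μ)/σ + (x-ν)/σ) * wt μ ν σ x) x := by
  have aux : ∀ c : ℝ, HasDerivAt (fun x => Real.exp (-(x - c) ^ 2 / (2 * σ ^ 2)))
      (Real.exp (-(x - c) ^ 2 / (2 * σ ^ 2)) * (-(2 * (x-c)) / (2 * σ^2))) x := by
    intro c
    have h := ((((hasDerivAt_id x).sub_const c).pow 2).neg.div_const (2*σ^2)).exp
    simpa using h
  refine ((aux μ).mul (aux ν)).congr_deriv ?_
  unfold wt
  field_simp
  ring

theorem hx_deriv {σ : ℝ} (n : ℕ) (c x : ℝ) :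
    HasDerivAt (fun x => hermiteP n ((x-c)/σ)) (2 * n * hermiteP (n-1) ((x-c)/σ) * (1/σ)) x := by
  have h1 : HasDerivAt (fun x : ℝ => (x-c)/σ) (1/σ) x :=
    ((hasDerivAt_id x).sub_const c).div_const σ
  exact (hp_deriv n ((x-c)/σ)).comp x h1

theorem II_rec1 {σ : ℝ} (hσ : 0 < σ) (μ ν : ℝ) (j k : ℕ) :
    II μ ν σ (j+1) k = 2 * k * II μ ν σ j (k-1) - (μ-ν)/σ * II μ ν σ j k := by
  have hd : ∀ x, HasDerivAt (fun x : ℝ => hermiteP j ((x-μ)/σ) * hermiteP k ((x-ν)/σ) * wt μ ν σ x)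
      ((1/σ) * (2 * k * (hermiteP j ((x-μ)/σ) * hermiteP (k-1) ((x-ν)/σ) * wt μ ν σ x)
        - (μ-ν)/σ * (hermiteP j ((x-μ)/σ) * hermiteP k ((x-ν)/σ) * wt μ ν σ x)
        - hermiteP (j+1) ((x-μ)/σ) * hermiteP k ((x-ν)/σ) * wt μ ν σ x)) x := by
    intro x
    refine (((hx_deriv j μ x).mul (hx_deriv k ν x)).mul (wt_deriv hσ μ ν x)).congr_deriv ?_
    have h := hp_rec j ((x-μ)/σ)
    have e : (x-ν)/σ = (x-μ)/σ + (μ-ν)/σ := by field_simp; ring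
    simp only [Pi.mul_apply]
    generalize hermiteP k ((x-ν)/σ) = a at *
    generalize hermiteP (k-1) ((x-ν)/σ) = b at *
    rw [e]
    linear_combination (-(1/σ) * a * wt μ ν σ x) * h
  have i1 := (int_hh hσ μ ν j (k-1)).const_mul (2*(k:ℝ))
  have i2 := (int_hh hσ μ ν j k).const_mul ((μ-ν)/σ)
  have i3 := int_hh hσ μ ν (j+1) k
  have h0 := integral_eq_zero_of_hasDerivAt_of_integrable hd
    (((i1.sub i2).sub i3).const_mul (1/σ)) (int_hh hσ μ ν j k)
  rw [integral_const_mul] at h0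
  have h1 := (mul_eq_zero.mp h0).resolve_left (by positivity)
  have h2 : (∫ x, 2 * k * (hermiteP j ((x-μ)/σ) * hermiteP (k-1) ((x-ν)/σ) * wt μ ν σ x)
        - (μ-ν)/σ * (hermiteP j ((x-μ)/σ) * hermiteP k ((x-ν)/σ) * wt μ ν σ x)
        - hermiteP (j+1) ((x-μ)/σ) * hermiteP k ((x-ν)/σ) * wt μ ν σ x)
      = 2 * k * II μ ν σ j (k-1) - (μ-ν)/σ * II μ ν σ j k - II μ ν σ (j+1) k := by
    have e1 := integral_sub (i1.sub i2) i3
    have e2 := integral_sub i1 i2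
    rw [integral_const_mul, integral_const_mul] at e2
    simp only [Pi.sub_apply] at e1
    rw [e2] at e1
    exact e1
  rw [h2] at h1
  linarith

theorem II_rec2 {σ : ℝ} (hσ : 0 < σ) (μ ν : ℝ) (j k : ℕ) :
    II μ ν σ j (k+1) = 2 * j * II μ ν σ (j-1) k + (μ-ν)/σ * II μ ν σ j k := by
  have := II_rec1 hσ ν μ k j
  rw [II_comm μ ν, II_comm μ ν, II_comm μ ν, this]
  ring

theorem II_zero {σ : ℝ} (hσ : 0 < σ) (μ ν : ℝ) :
    II μ ν σ 0 0 = Real.exp (-(μ-ν)^2/(4*σ^2)) * (σ * √Real.pi) := by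
  unfold II
  simp only [hermiteP, one_mul, wt_eq hσ]
  rw [integral_const_mul]
  congr 1
  rw [integral_sub_right_eq_self (fun x : ℝ => Real.exp (-(1/σ^2) * x^2)), integral_gaussian]
  rw [show Real.pi / (1/σ^2) = σ^2 * Real.pi by field_simp, Real.sqrt_mul (by positivity),
    Real.sqrt_sq hσ.le]

/-- normalising constant -/
noncomputable def nc (σ : ℝ) (j : ℕ) : ℝ :=
  (-1 : ℝ) ^ j * (Real.sqrt (2 ^ j * (Nat.factorial j : ℝ) * σ * Real.sqrt Real.pi))⁻¹

theorem nc_succ {σ : ℝ} (hσ : 0 < σ) (j : ℕ) : √((j:ℝ)+1) * nc σ (j+1) = - (nc σ j) / √2 := by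
  unfold nc
  have hp : 0 < √Real.pi := Real.sqrt_pos.mpr Real.pi_pos
  have e : (2:ℝ)^(j+1) * ((j+1).factorial : ℝ) * σ * √Real.pi
      = 2 * ((j:ℝ)+1) * (2^j * (j.factorial:ℝ) * σ * √Real.pi) := by
    rw [Nat.factorial_succ]; push_cast; ring
  rw [e, Real.sqrt_mul (by positivity), Real.sqrt_mul (by positivity), pow_succ]
  have h1 : √((j:ℝ)+1) ≠ 0 := by positivity
  have h2 : √(2^j * (j.factorial:ℝ) * σ * √Real.pi) ≠ 0 := by positivity
  have h3 : √(2:ℝ) ≠ 0 := by positivity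
  generalize √((j:ℝ)+1) = a at *
  generalize √(2^j * (j.factorial:ℝ) * σ * √Real.pi) = b at *
  generalize √(2:ℝ) = c at *
  field_simp

theorem nc_pred {σ : ℝ} (hσ : 0 < σ) (k : ℕ) (F : ℕ → ℝ) :
    -(2 / √2) * (nc σ k * k * F (k-1)) = √(k:ℝ) * (nc σ (k-1) * F (k-1)) := by
  cases k with
  | zero => simp
  | succ k =>
    have h := nc_succ hσ k
    have h3 : √(2:ℝ) ≠ 0 := by positivity
    have h4 : √(2:ℝ) * √2 = 2 := Real.mul_self_sqrt (by norm_num)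
    have h5 : √((k:ℝ)+1) * √((k:ℝ)+1) = (k:ℝ)+1 := Real.mul_self_sqrt (by positivity)
    have h6 : nc σ k = - √2 * (√((k:ℝ)+1) * nc σ (k+1)) := by rw [h]; field_simp
    simp only [Nat.add_sub_cancel]
    push_cast
    have h7 : 2 / √2 = √2 := by field_simp; linarith
    rw [h6, h7]
    linear_combination (√2 * nc σ (k+1) * F k) * h5

noncomputable def EE (σ μ ν : ℝ) (j k : ℕ) : ℝ := ip (psiH j μ σ) (psiH k ν σ)

theorem EE_eq (σ μ ν : ℝ) (j k : ℕ) : EE σ μ ν j k = nc σ j * nc σ k * II μ ν σ j k := by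
  unfold EE ip II
  rw [← integral_const_mul]
  congr 1; funext x
  unfold psiH nc wt
  ring

theorem EE_comm (σ μ ν : ℝ) (j k : ℕ) : EE σ μ ν j k = EE σ ν μ k j := by
  rw [EE_eq, EE_eq, II_comm]; ring

theorem EE_lad {σ : ℝ} (hσ : 0 < σ) (μ ν : ℝ) : Lad ((μ-ν)/(√2*σ)) (EE σ μ ν) := by
  have h3 : √(2:ℝ) ≠ 0 := by positivity
  have h4 : √(2:ℝ) ^ 2 = 2 := Real.sq_sqrt (by norm_num)
  refine ⟨?_, ?_, ?_⟩
  · rw [EE_eq, II_zero hσ]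
    unfold nc
    have hp : 0 < σ * √Real.pi := mul_pos hσ (Real.sqrt_pos.mpr Real.pi_pos)
    have h5 : √(σ * √Real.pi) ^ 2 = σ * √Real.pi := Real.sq_sqrt hp.le
    have h6 : √(σ * √Real.pi) ≠ 0 := by positivity
    simp only [pow_zero, Nat.factorial_zero, Nat.cast_one, one_mul]
    have e : -((μ-ν)/(√2*σ))^2/2 = -(μ-ν)^2/(4*σ^2) := by
      rw [div_pow, mul_pow, h4]; field_simp; ring
    rw [e]
    generalize √(σ * √Real.pi) = q at *
    rw [← h5]
    field_simp
  · intro n k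
    rw [EE_eq, EE_eq, EE_eq, II_rec1 hσ]
    have h := nc_succ hσ n
    have h' : -(2 / √2) * (nc σ k * k * II μ ν σ n (k-1)) = √(k:ℝ) * (nc σ (k-1) * II μ ν σ n (k-1)) :=
      nc_pred hσ k (fun m => II μ ν σ n m)
    have e : (μ-ν)/(√2*σ) = (μ-ν)/σ/√2 := by field_simp
    rw [e]
    linear_combination (nc σ k * (2 * k * II μ ν σ n (k-1) - (μ-ν)/σ * II μ ν σ n k)) * h
      + nc σ n * h'
  · intro n k
    rw [EE_eq, EE_eq, EE_eq, II_rec2 hσ]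
    have h := nc_succ hσ k
    have h' : -(2 / √2) * (nc σ n * n * II μ ν σ (n-1) k) = √(n:ℝ) * (nc σ (n-1) * II μ ν σ (n-1) k) :=
      nc_pred hσ n (fun m => II μ ν σ m k)
    have e : (μ-ν)/(√2*σ) = (μ-ν)/σ/√2 := by field_simp
    rw [e]
    linear_combination (nc σ n * (2 * n * II μ ν σ (n-1) k + (μ-ν)/σ * II μ ν σ n k)) * h
      + nc σ k * h'

theorem EE_diag {σ : ℝ} (hσ : 0 < σ) (μ : ℝ) (j k : ℕ) :
    EE σ μ μ j k = if j = k then 1 else 0 := by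
  have h := EE_lad hσ μ μ
  rw [sub_self, zero_div] at h
  refine delta_of_rec (EE σ μ μ) ?_ ?_ ?_ j k
  · simpa using h.h0
  · intro j k; simpa using h.h1 j k
  · intro k; simpa using h.h2 0 k

theorem lad_zero {α : ℝ} {D : ℕ → ℕ → ℝ} (h : Lad α D) (k : ℕ) :
    D 0 k = Real.exp (-α^2/2) * uu (-α) k := by
  induction k with
  | zero => rw [h.h0]; simp [uu]
  | succ k ih =>
    have h2 := h.h2 0 k
    simp only [Nat.cast_zero, Real.sqrt_zero, zero_mul, zero_sub] at h2
    have h3 := uu_succ (-α) k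
    have h1 : √((k:ℝ)+1) ≠ 0 := by positivity
    apply mul_left_cancel₀ h1
    rw [h2, ih]
    linear_combination (-Real.exp (-α^2/2)) * h3

theorem EE0_bound {σ : ℝ} (hσ : 0 < σ) {u c R r : ℝ} (hr : 0 < r) (hR : |u - c| ≤ R) (k : ℕ) :
    |EE σ u c 0 k| ≤ (R/r)^k * |uu (r/(√2*σ)) k| := by
  rw [lad_zero (EE_lad hσ u c), abs_mul, Real.abs_exp]
  have h1 : Real.exp (-((u-c)/(√2*σ))^2/2) ≤ 1 := by
    rw [Real.exp_le_one_iff]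
    have := sq_nonneg ((u-c)/(√2*σ))
    linarith
  refine (mul_le_of_le_one_left (abs_nonneg _) h1).trans ?_
  unfold uu
  rw [abs_div, abs_div, abs_pow, abs_pow, abs_neg, abs_div, abs_div, abs_of_pos hr, ← mul_div_assoc,
    ← mul_pow]
  have h2 : 0 < |√2*σ| := by positivity
  have : R / r * (r / |√2*σ|) = R / |√2*σ| := by field_simp
  rw [this]
  gcongr

end S17
namespace S17
open Polynomial

theorem psi_int {σ : ℝ} (hσ : 0 < σ) (j : ℕ) (c : ℝ) : Integrable (psiH j c σ) := by
  obtain ⟨p, hp⟩ := hp_poly j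
  have := (int_poly (p.comp (C σ⁻¹ * (X - C c))) (b := 1/(2*σ^2)) (by positivity) c).const_mul
    (nc σ j)
  refine this.congr (Filter.Eventually.of_forall fun x => ?_)
  have e : -(1/(2*σ^2)) * (x-c)^2 = -(x - c) ^ 2 / (2 * σ ^ 2) := by ring
  simp only [psiH, nc, hp, eval_comp, eval_mul, eval_C, eval_sub, eval_X]
  rw [e, div_eq_inv_mul (x - c) σ]
  ring

theorem gauss_eq {σ : ℝ} (hσ : 0 < σ) (u x : ℝ) :
    gaussD u σ x = 1 / √(2 * σ * √Real.pi) * psiH 0 u σ x := by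
  have hp : 0 < σ * √Real.pi := mul_pos hσ (Real.sqrt_pos.mpr Real.pi_pos)
  have h5 : √(σ * √Real.pi) ^ 2 = σ * √Real.pi := Real.sq_sqrt hp.le
  have h6 : √(σ * √Real.pi) ≠ 0 := by positivity
  have h3 : √(2:ℝ) ≠ 0 := by positivity
  have h7 : √Real.pi ≠ 0 := by positivity
  unfold gaussD psiH
  simp only [pow_zero, Nat.factorial_zero, Nat.cast_one, one_mul, hermiteP, mul_one]
  rw [Real.sqrt_mul (by norm_num : (0:ℝ) ≤ 2) Real.pi, mul_assoc 2 σ, Real.sqrt_mul (by norm_num : (0:ℝ) ≤ 2),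
    ← mul_assoc]
  congr 1
  generalize √(σ * √Real.pi) = q at *
  field_simp
  linarith

theorem lam_eq {σ : ℝ} (hσ : 0 < σ) (V : Measure ℝ) [IsProbabilityMeasure V] (j : ℕ) (c : ℝ) :
    ip (fun x => ∫ u, gaussD u σ x ∂V) (psiH j c σ)
      = ∫ u, 1 / √(2 * σ * √Real.pi) * EE σ u c 0 j ∂V := by
  unfold ip
  have e : ∀ x, (∫ u, gaussD u σ x ∂V) * psiH j c σ x = ∫ u, gaussD u σ x * psiH j c σ x ∂V := by
    intro x; rw [integral_mul_const]
  simp only [e]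
  rw [integral_integral_swap]
  · congr 1; funext u
    unfold EE ip
    rw [← integral_const_mul]
    congr 1; funext x
    rw [gauss_eq hσ]; ring
  · have hi : Integrable (fun z : ℝ × ℝ => psiH j c σ z.1) ((volume : Measure ℝ).prod V) :=
      (psi_int hσ j c).comp_fst V
    refine Integrable.bdd_mul (c := 1 / (√(2 * Real.pi) * σ)) hi ?_ ?_
    · apply Continuous.aestronglyMeasurable
      unfold gaussD
      fun_prop
    · refine Filter.Eventually.of_forall fun z => ?_
      unfold gaussD
      have h1 : Real.exp (-(z.1 - z.2) ^ 2 / (2 * σ ^ 2)) ≤ 1 := by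
        rw [Real.exp_le_one_iff, neg_div]
        have : 0 ≤ (z.1 - z.2) ^ 2 / (2 * σ ^ 2) := by positivity
        linarith
      rw [Real.norm_of_nonneg (by positivity)]
      exact mul_le_of_le_one_right (by positivity) h1

theorem lam_bound {σ : ℝ} (hσ : 0 < σ) (V : Measure ℝ) [IsProbabilityMeasure V] (j : ℕ) {c R ρ r : ℝ}
    (hr : 0 < r) (hρ : ρ ≤ R) (hs : V (Set.Icc (c - ρ) (c + ρ))ᶜ = 0) :
    |ip (fun x => ∫ u, gaussD u σ x ∂V) (psiH j c σ)|
      ≤ 1 / √(2 * σ * √Real.pi) * ((R/r)^j * |uu (r/(√2*σ)) j|) := by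
  rw [lam_eq hσ]
  have h := norm_integral_le_of_norm_le_const (μ := V)
    (f := fun u => 1 / √(2 * σ * √Real.pi) * EE σ u c 0 j)
    (C := 1 / √(2 * σ * √Real.pi) * ((R/r)^j * |uu (r/(√2*σ)) j|)) ?_
  · simpa using h
  · have : ∀ᵐ u ∂V, u ∈ Set.Icc (c - ρ) (c + ρ) := by
      rw [ae_iff]; exact hs
    filter_upwards [this] with u hu
    rw [norm_mul, Real.norm_of_nonneg (by positivity : 0 ≤ 1 / √(2 * σ * √Real.pi))]
    refine mul_le_mul_of_nonneg_left ?_ (by positivity)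
    refine EE0_bound hσ hr ?_ j
    rw [abs_le]
    constructor <;> linarith [hu.1, hu.2]

theorem core_A {σ c₁ c₂ : ℝ} (hσ : 0 < σ) (hc : c₁ < c₂) (l : ℕ)
    (hu : IsUnit (matA l c₁ c₂ σ).det) (j : ℕ) (hj : l ≤ j) (i : Fin 2) (k : Fin l) :
    |((matA l c₁ c₂ σ)⁻¹.mulVec (zvec1 l c₁ c₂ σ j)) (i, k)| * |uu ((c₂-c₁)/(√2*σ)) j|
        ≤ Real.exp (((c₂-c₁)/(√2*σ))^2/2) * (4^l * 2^j / 2) ∧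
    |((matA l c₁ c₂ σ)⁻¹.mulVec (zvec2 l c₁ c₂ σ j)) (i, k)| * |uu ((c₂-c₁)/(√2*σ)) j|
        ≤ Real.exp (((c₂-c₁)/(√2*σ))^2/2) * (4^l * 2^j / 2) := by
  have hs : ∀ z : Fin 2 × Fin l → ℝ, ∀ y, y = (matA l c₁ c₂ σ)⁻¹.mulVec z →
      (∀ k : Fin l, y (0,k) + ∑ m : Fin l, EE σ c₁ c₂ k m * y (1,m) = z (0,k)) ∧
      (∀ k : Fin l, (∑ m : Fin l, EE σ c₁ c₂ m k * y (0,m)) + y (1,k) = z (1,k)) := by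
    intro z y hy
    have h : (matA l c₁ c₂ σ).mulVec y = z := by
      rw [hy, Matrix.mulVec_mulVec, Matrix.mul_nonsing_inv _ hu, Matrix.one_mulVec]
    have hd : ∀ c : ℝ, ∀ k : Fin l, ∀ f : Fin l → ℝ, ∑ m : Fin l, EE σ c c k m * f m = f k := by
      intro c k f
      simp only [EE_diag hσ]
      rw [Finset.sum_eq_single k]
      · simp
      · intro b _ hb
        rw [if_neg (fun e => hb (Fin.ext e.symm)), zero_mul]
      · simp
    constructor
    · intro k
      have := congrFun h (0, k)
      rw [← this]
      simp only [Matrix.mulVec, dotProduct, matA, Matrix.of_apply, Fintype.sum_prod_type,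
        Fin.sum_univ_two, cent]
      have h1 := hd c₁ k (fun m => y (0,m))
      simp only [EE] at h1 ⊢
      simp only [Matrix.cons_val_zero, Matrix.cons_val_one]
      rw [h1]
    · intro k
      have := congrFun h (1, k)
      rw [← this]
      simp only [Matrix.mulVec, dotProduct, matA, Matrix.of_apply, Fintype.sum_prod_type,
        Fin.sum_univ_two, cent]
      have h1 := hd c₂ k (fun m => y (1,m))
      simp only [EE_comm σ c₁ c₂]
      simp only [EE] at h1 ⊢
      simp only [Matrix.cons_val_zero, Matrix.cons_val_one]
      rw [h1]
  have hα : (c₂-c₁)/(√2*σ) ≠ 0 := by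
    have : 0 < c₂ - c₁ := by linarith
    positivity
  have e1 : (c₁-c₂)/(√2*σ) = -((c₂-c₁)/(√2*σ)) := by ring
  have L1 := EE_lad hσ c₁ c₂
  have L2 := EE_lad hσ c₂ c₁
  have hα1 : (c₁-c₂)/(√2*σ) ≠ 0 := by rw [e1]; exact neg_ne_zero.mpr hα
  have hun : |uu ((c₁-c₂)/(√2*σ)) j| = |uu ((c₂-c₁)/(√2*σ)) j| := by
    rw [e1]; unfold uu; rw [abs_div, abs_div, abs_pow, abs_pow, abs_neg]
  constructor
  · obtain ⟨h1, h2⟩ := hs (zvec1 l c₁ c₂ σ j) _ rfl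
    have := core hα1 L1 l j hj (fun t => by
      obtain ⟨g1, g2⟩ := hs (fun p => if p.1 = 0 then 0 else t p.2) _ rfl
      exact ⟨_, _, fun k => by simpa using g1 k, fun k => by simpa using g2 k⟩)
      (fun k => ((matA l c₁ c₂ σ)⁻¹.mulVec (zvec1 l c₁ c₂ σ j)) (0, k))
      (fun k => ((matA l c₁ c₂ σ)⁻¹.mulVec (zvec1 l c₁ c₂ σ j)) (1, k))
      (fun k => (h1 k).trans (by simp [zvec1])) (fun k => (h2 k).trans (by simp [zvec1, EE])) k
    rw [hun, e1, neg_sq] at this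
    fin_cases i
    · exact this.1
    · exact this.2
  · obtain ⟨h1, h2⟩ := hs (zvec2 l c₁ c₂ σ j) _ rfl
    have := core hα L2 l j hj (fun t => by
      obtain ⟨g1, g2⟩ := hs (fun p => if p.1 = 0 then t p.2 else 0) _ rfl
      refine ⟨fun m => (matA l c₁ c₂ σ)⁻¹.mulVec (fun p => if p.1 = 0 then t p.2 else 0) (1, m),
        fun m => (matA l c₁ c₂ σ)⁻¹.mulVec (fun p => if p.1 = 0 then t p.2 else 0) (0, m),
        fun k => ?_, fun k => ?_⟩
      · have := g2 k
        simp only [EE_comm σ c₁ c₂] at this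
        rw [add_comm] at this
        simpa using this
      · have := g1 k
        simp only [EE_comm σ c₁ c₂] at this
        rw [add_comm] at this
        simpa using this)
      (fun k => ((matA l c₁ c₂ σ)⁻¹.mulVec (zvec2 l c₁ c₂ σ j)) (1, k))
      (fun k => ((matA l c₁ c₂ σ)⁻¹.mulVec (zvec2 l c₁ c₂ σ j)) (0, k))
      (fun k => by
        have := h2 k
        simp only [EE_comm σ c₁ c₂] at this
        rw [add_comm] at this
        exact this.trans (by simp [zvec2]))
      (fun k => by
        have := h1 k
        simp only [EE_comm σ c₁ c₂] at this
        rw [add_comm] at this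
        exact this.trans (by simp [zvec2, EE])) k
    fin_cases i
    · exact this.2
    · exact this.1

theorem geo_sub (l : ℕ) (K x : ℝ) (h0 : 0 ≤ x) (h1 : x < 1) :
    HasSum (fun j : {j : ℕ // l ≤ j} => K * x^(j:ℕ)) (K * (x^l / (1-x))) := by
  let e : ℕ ≃ {j : ℕ // l ≤ j} :=
    { toFun := fun n => ⟨n + l, Nat.le_add_left _ _⟩
      invFun := fun j => j.1 - l
      left_inv := fun n => by simp
      right_inv := fun j => by
        apply Subtype.ext
        simp [Nat.sub_add_cancel j.2] }
  rw [← e.hasSum_iff]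
  have := ((hasSum_geometric_of_lt_one h0 h1).mul_left (K * x^l))
  rw [mul_div_assoc', div_eq_mul_inv]
  refine hs_congr this fun n => ?_
  simp only [Function.comp, e, Equiv.coe_fn_mk]
  ring

theorem term_bound {w lam y U κ q x E F : ℝ} (hw : 0 < w) (hw' : w ≤ 1) (hκ : 0 ≤ κ) (hq : 0 ≤ q)
    (h1 : |lam| ≤ κ * (q * U)) (h2 : |y| * U ≤ E) (hF : κ * q * E = F) :
    ‖w * lam * y‖ ≤ F := by
  rw [← hF, Real.norm_eq_abs, abs_mul, abs_mul, abs_of_pos hw]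
  have h3 : w * |lam| ≤ |lam| := mul_le_of_le_one_left (abs_nonneg _) hw'
  calc w * |lam| * |y| ≤ |lam| * |y| := mul_le_mul_of_nonneg_right h3 (abs_nonneg _)
    _ ≤ (κ * (q * U)) * |y| := mul_le_mul_of_nonneg_right h1 (abs_nonneg _)
    _ = κ * q * (|y| * U) := by ring
    _ ≤ κ * q * E := mul_le_mul_of_nonneg_left h2 (by positivity)

end S17

/-- Entrywise bound on the truncation error
`𝓔_t = Σ_{j≥ℓ} λ_{1,j} A⁻¹ z_{1,j} + Σ_{j≥ℓ} λ_{2,j} A⁻¹ z_{2,j}` under the separation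
condition `8 max(r₁,r₂) < r`, and vanishing of the bound as `ℓ → ∞`. -/
theorem stmt17 (σ c₁ c₂ r₁ r₂ w₁ w₂ : ℝ) (V : Fin 2 → Measure ℝ)
    (hσ : 0 < σ) (hc : c₁ < c₂) (hr₁ : 0 < r₁) (hr₂ : 0 < r₂)
    (hw₁ : 0 < w₁) (hw₁' : w₁ ≤ 1) (hw₂ : 0 < w₂) (hw₂' : w₂ ≤ 1)
    (hV : ∀ i, IsProbabilityMeasure (V i))
    (hs1 : V 0 (Set.Icc (c₁ - r₁) (c₁ + r₁))ᶜ = 0)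
    (hs2 : V 1 (Set.Icc (c₂ - r₂) (c₂ + r₂))ᶜ = 0)
    (hsep : 8 * max r₁ r₂ < c₂ - c₁) :
    (∀ (ℓ : ℕ) (i : Fin 2) (k : Fin ℓ),
      |(∑' j : {j : ℕ // ℓ ≤ j},
          w₁ * ip (fun x => ∫ u, gaussD u σ x ∂(V 0)) (psiH j c₁ σ) *
            ((matA ℓ c₁ c₂ σ)⁻¹.mulVec (zvec1 ℓ c₁ c₂ σ j)) (i, k)) +
        (∑' j : {j : ℕ // ℓ ≤ j},
          w₂ * ip (fun x => ∫ u, gaussD u σ x ∂(V 1)) (psiH j c₂ σ) *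
            ((matA ℓ c₁ c₂ σ)⁻¹.mulVec (zvec2 ℓ c₁ c₂ σ j)) (i, k))| ≤
        (c₂ - c₁) * Real.exp (5 * (c₂ - c₁) ^ 2 / (4 * σ ^ 2)) /
            (Real.sqrt (2 * σ * Real.sqrt Real.pi) * ((c₂ - c₁) - 2 * max r₁ r₂)) *
          ((8 * max r₁ r₂) / (c₂ - c₁)) ^ ℓ) ∧
    Filter.Tendsto
      (fun ℓ : ℕ =>
        (c₂ - c₁) * Real.exp (5 * (c₂ - c₁) ^ 2 / (4 * σ ^ 2)) /
            (Real.sqrt (2 * σ * Real.sqrt Real.pi) * ((c₂ - c₁) - 2 * max r₁ r₂)) *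
          ((8 * max r₁ r₂) / (c₂ - c₁)) ^ ℓ)
      Filter.atTop (nhds 0) := by
  have hM : 0 < max r₁ r₂ := lt_max_of_lt_left hr₁
  have hr : 0 < c₂ - c₁ := by linarith
  have hden : 0 < (c₂ - c₁) - 2 * max r₁ r₂ := by linarith
  have hκ : 0 < Real.sqrt (2 * σ * Real.sqrt Real.pi) :=
    Real.sqrt_pos.mpr (mul_pos (by positivity) (Real.sqrt_pos.mpr Real.pi_pos))
  refine ⟨?_, ?_⟩
  · intro ℓ i k
    have := hV 0
    have := hV 1
    by_cases hu : IsUnit (matA ℓ c₁ c₂ σ).det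
    · have hle1 : r₁ ≤ max r₁ r₂ := le_max_left _ _
      have hle2 : r₂ ≤ max r₁ r₂ := le_max_right _ _
      generalize max r₁ r₂ = R at *
      set r := c₂ - c₁ with hrdef
      set κ := 1 / Real.sqrt (2 * σ * Real.sqrt Real.pi) with hκdef
      have hκ0 : 0 < κ := by positivity
      have hx0 : 0 ≤ 2 * (R / r) := by positivity
      have hx1 : 2 * (R / r) < 1 := by
        rw [← mul_div_assoc, div_lt_one hr]; linarith
      have hg := S17.geo_sub ℓ (κ * Real.exp ((r/(√2*σ))^2/2) * 4^ℓ / 2) (2 * (R/r)) hx0 hx1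
      have hF : ∀ j : ℕ, κ * (R/r)^j * (Real.exp ((r/(√2*σ))^2/2) * (4^ℓ * 2^j / 2))
          = κ * Real.exp ((r/(√2*σ))^2/2) * 4^ℓ / 2 * (2 * (R/r))^j := by
        intro j; rw [mul_pow]; ring
      have b1 := tsum_of_norm_bounded (f := fun j : {j : ℕ // ℓ ≤ j} =>
          w₁ * ip (fun x => ∫ u, gaussD u σ x ∂(V 0)) (psiH j c₁ σ) *
            ((matA ℓ c₁ c₂ σ)⁻¹.mulVec (zvec1 ℓ c₁ c₂ σ j)) (i, k)) hg (fun j =>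
        S17.term_bound (x := 0) hw₁ hw₁' hκ0.le (by positivity) (S17.lam_bound hσ (V 0) j hr hle1 hs1)
          (S17.core_A hσ hc ℓ hu j j.2 i k).1 (hF j))
      have b2 := tsum_of_norm_bounded (f := fun j : {j : ℕ // ℓ ≤ j} =>
          w₂ * ip (fun x => ∫ u, gaussD u σ x ∂(V 1)) (psiH j c₂ σ) *
            ((matA ℓ c₁ c₂ σ)⁻¹.mulVec (zvec2 ℓ c₁ c₂ σ j)) (i, k)) hg (fun j =>
        S17.term_bound (x := 0) hw₂ hw₂' hκ0.le (by positivity) (S17.lam_bound hσ (V 1) j hr hle2 hs2)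
          (S17.core_A hσ hc ℓ hu j j.2 i k).2 (hF j))
      rw [Real.norm_eq_abs] at b1 b2
      refine (abs_add_le _ _).trans ((add_le_add b1 b2).trans ?_)
      have he : Real.exp ((r/(√2*σ))^2/2) ≤ Real.exp (5 * r ^ 2 / (4 * σ ^ 2)) := by
        apply Real.exp_le_exp.mpr
        rw [div_pow, mul_pow, Real.sq_sqrt (by norm_num)]
        rw [div_div, div_le_div_iff₀ (by positivity) (by positivity)]
        have : 0 ≤ r^2 * σ^2 := by positivity
        nlinarith
      have e1 : κ * Real.exp ((r/(√2*σ))^2/2) * 4^ℓ / 2 * ((2 * (R/r))^ℓ / (1 - 2 * (R/r)))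
          + κ * Real.exp ((r/(√2*σ))^2/2) * 4^ℓ / 2 * ((2 * (R/r))^ℓ / (1 - 2 * (R/r)))
          = r * Real.exp ((r/(√2*σ))^2/2) /
            (Real.sqrt (2 * σ * Real.sqrt Real.pi) * (r - 2 * R)) * ((8 * R) / r) ^ ℓ := by
        have e2 : (8 * R / r)^ℓ = 4^ℓ * (2 * (R/r))^ℓ := by
          rw [← mul_pow]; congr 1; ring
        have e3 : 1 - 2 * (R/r) = (r - 2 * R) / r := by field_simp
        rw [e2, e3, hκdef]
        generalize (2 * (R/r))^ℓ = A
        generalize Real.exp ((r/(√2*σ))^2/2) = B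
        generalize Real.sqrt (2 * σ * Real.sqrt Real.pi) = Q at *
        field_simp
        ring
      rw [e1]
      gcongr
    · rw [Matrix.nonsing_inv_apply_not_isUnit _ hu]
      simp only [Matrix.zero_mulVec, Pi.zero_apply, mul_zero, tsum_zero, add_zero, abs_zero]
      positivity
  · have h := (tendsto_pow_atTop_nhds_zero_of_lt_one (r := (8 * max r₁ r₂) / (c₂ - c₁))
      (by positivity) (by rw [div_lt_one hr]; exact hsep)).const_mul
      ((c₂ - c₁) * Real.exp (5 * (c₂ - c₁) ^ 2 / (4 * σ ^ 2)) /
            (Real.sqrt (2 * σ * Real.sqrt Real.pi) * ((c₂ - c₁) - 2 * max r₁ r₂)))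
    rw [mul_zero] at h
    exact h
end
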